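/- arXiv:2001.01814 — 4 statements merged into one kernel-verified Lean document; each statement's English description precedes it below -/
import Mathlib

section
/- Let d be a positive squarefree integer and let K = ℚ(√−d) be the corresponding imaginary quadratic field. Then the 2-torsion subgroup of the ideal class group Cl(K) is an elementary abelian 2-group whose 𝔽₂-dimension is exactly one less than the number of distinct prime numbers dividing the discriminant Δ_{K/ℚ}; equivalently, the number of elements x of Cl(K) with x² = 1 equals 2^(t−1), where t is the number of distinct prime divisors of the absolute value of the discriminant of K. -/
open NumberField

theorem gq_basis (d : ℕ) (hd : 0 < d)
    (K : Type) [Field K] [NumberField K]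
    (α : K) (hα : α ^ 2 = -(d : K)) (hgen : Algebra.adjoin ℚ {α} = ⊤) :
    ∃ b : Module.Basis (Fin 2) ℚ K, b 0 = 1 ∧ b 1 = α := by
  have hli : LinearIndependent ℚ ![(1 : K), α] := by
    rw [LinearIndependent.pair_iff]
    intro s t h
    rw [Algebra.smul_def, Algebra.smul_def, mul_one] at h
    have ht : t = 0 := by
      have h1 : algebraMap ℚ K s = - (algebraMap ℚ K t * α) := by linear_combination h
      have h2 : algebraMap ℚ K (s^2 + t^2 * d) = algebraMap ℚ K 0 := by
        simp only [map_add, map_mul, map_pow, map_natCast, map_zero]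
        rw [h1]
        linear_combination (algebraMap ℚ K t)^2 * hα
      have h3 := (algebraMap ℚ K).injective h2
      have hd' : (0:ℚ) < d := by exact_mod_cast hd
      have : t^2 * d = 0 := by nlinarith [sq_nonneg s, mul_nonneg (sq_nonneg t) hd'.le]
      rcases mul_eq_zero.mp this with h | h
      · exact pow_eq_zero_iff (two_ne_zero) |>.mp h
      · exact absurd h hd'.ne'
    subst ht
    simp at h
    exact ⟨h, rfl⟩
  have hsp : ⊤ ≤ Submodule.span ℚ (Set.range ![(1 : K), α]) := by
    intro x _
    have hx : x ∈ Algebra.adjoin ℚ {α} := hgen ▸ Algebra.mem_top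
    rw [Matrix.range_cons, Matrix.range_cons, Matrix.range_empty, Set.union_empty,
      Set.singleton_union, Submodule.mem_span_pair]
    induction hx using Algebra.adjoin_induction with
    | mem x hx => rw [Set.mem_singleton_iff.mp hx]; exact ⟨0, 1, by simp⟩
    | algebraMap r => exact ⟨r, 0, by simp [Algebra.smul_def]⟩
    | add x y _ _ hx hy =>
      obtain ⟨a, b, rfl⟩ := hx trivial
      obtain ⟨a', b', rfl⟩ := hy trivial
      exact ⟨a + a', b + b', by module⟩
    | mul x y _ _ hx hy =>
      obtain ⟨a, b, rfl⟩ := hx trivial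
      obtain ⟨a', b', rfl⟩ := hy trivial
      refine ⟨a * a' - b * b' * d, a * b' + a' * b, ?_⟩
      simp only [Algebra.smul_def, map_add, map_sub, map_mul, map_natCast]
      linear_combination -(algebraMap ℚ K b) * (algebraMap ℚ K b') * hα
  exact ⟨Module.Basis.mk hli hsp, by simp, by simp⟩

theorem gq_coords (d : ℕ) (hd : 0 < d)
    (K : Type) [Field K] [NumberField K]
    (α : K) (hα : α ^ 2 = -(d : K)) (hgen : Algebra.adjoin ℚ {α} = ⊤) (x : K) :
    ∃ r s : ℚ, x = r + s * α := by
  obtain ⟨b, h0, h1⟩ := gq_basis d hd K α hα hgen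
  refine ⟨b.repr x 0, b.repr x 1, ?_⟩
  have := b.sum_repr x
  rw [Fin.sum_univ_two, h0, h1] at this
  simpa [Algebra.smul_def] using this.symm

theorem gq_tr_norm (d : ℕ) (hd : 0 < d)
    (K : Type) [Field K] [NumberField K]
    (α : K) (hα : α ^ 2 = -(d : K)) (hgen : Algebra.adjoin ℚ {α} = ⊤) (r s : ℚ) :
    Algebra.trace ℚ K (r + s * α) = 2 * r ∧ Algebra.norm ℚ ((r : K) + s * α) = r^2 + d * s^2 := by
  obtain ⟨b, h0, h1⟩ := gq_basis d hd K α hα hgen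
  have hm : Algebra.leftMulMatrix b ((r : K) + s * α) = !![r, -(d * s); s, r] := by
    have e0 : ((r : K) + s * α) * b 0 = r • b 0 + s • b 1 := by
      rw [h0, h1]; simp [Algebra.smul_def]
    have e1 : ((r : K) + s * α) * b 1 = (-(d * s)) • b 0 + r • b 1 := by
      rw [h0, h1]; simp [Algebra.smul_def]
      linear_combination (s : K) * hα
    ext i j
    rw [Algebra.leftMulMatrix_eq_repr_mul]
    fin_cases j
    · simp only [Fin.zero_eta, e0]
      fin_cases i <;> simp
    · simp only [Fin.mk_one, e1]
      fin_cases i <;> simp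
  rw [Algebra.trace_eq_matrix_trace b, Algebra.norm_eq_matrix_det b, hm]
  constructor
  · simp [Matrix.trace_fin_two]; ring
  · simp [Matrix.det_fin_two]; ring

theorem gq_int_of_sq (d : ℕ) (hsf : Squarefree d) (b : ℚ) (k : ℤ) (h : d * b^2 = k) :
    ∃ m : ℤ, b = m := by
  have h1 : (d : ℤ) * b.num ^ 2 = k * (b.den : ℤ)^2 := by
    have hb : (b.den : ℚ) ≠ 0 := by exact_mod_cast b.den_ne_zero
    rw [← Rat.num_div_den b] at h
    field_simp at h
    rw [mul_comm k]
    exact_mod_cast h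
  have hc : IsCoprime ((b.den : ℤ)^2) (b.num^2) := by
    apply IsCoprime.pow
    exact (Int.isCoprime_iff_gcd_eq_one.mpr (by rw [Int.gcd_eq_natAbs]; exact b.reduced)).symm
  have h2 : (b.den : ℤ)^2 ∣ d := hc.dvd_of_dvd_mul_right ⟨k, by rw [h1]; ring⟩
  have h3 : b.den * b.den ∣ d := by rw [← pow_two]; exact_mod_cast h2
  have := Nat.isUnit_iff.mp (hsf _ h3)
  exact ⟨b.num, (Rat.den_eq_one_iff b |>.mp this).symm⟩

/-- Every integer is `(a + bα)/2`. -/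
theorem gq_int_coords (d : ℕ) (hd : 0 < d) (hsf : Squarefree d)
    (K : Type) [Field K] [NumberField K]
    (α : K) (hα : α ^ 2 = -(d : K)) (hgen : Algebra.adjoin ℚ {α} = ⊤) (x : 𝓞 K) :
    ∃ a b n : ℤ, 2 * (x : K) = a + b * α ∧ 4 * n = a^2 + d * b^2 ∧ Algebra.norm ℤ x = n := by
  obtain ⟨r, s, hx⟩ := gq_coords d hd K α hα hgen (x : K)
  obtain ⟨ht, hn⟩ := gq_tr_norm d hd K α hα hgen r s
  rw [← hx] at ht hn
  have ht' : ((Algebra.trace ℤ (𝓞 K) x : ℤ) : ℚ) = 2 * r := by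
    rw [← ht]; exact Algebra.coe_trace_int x
  have hn' : ((Algebra.norm ℤ x : ℤ) : ℚ) = r^2 + d * s^2 := by
    rw [← hn]; exact Algebra.coe_norm_int x
  obtain ⟨b, hb⟩ := gq_int_of_sq d hsf (2 * s)
    (4 * Algebra.norm ℤ x - (Algebra.trace ℤ (𝓞 K) x)^2) (by
      push_cast; rw [hn', ht']; ring)
  refine ⟨Algebra.trace ℤ (𝓞 K) x, b, Algebra.norm ℤ x, ?_, ?_, rfl⟩
  · rw [hx]
    have e1 : ((Algebra.trace ℤ (𝓞 K) x : ℤ) : K) = ((2 * r : ℚ) : K) := by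
      rw [← ht']; simp
    have e2 : ((b : ℤ) : K) = ((2 * s : ℚ) : K) := by rw [hb]; simp
    rw [e1, e2]; push_cast; ring
  · have : (4 * (Algebra.norm ℤ x : ℤ) : ℚ) = (Algebra.trace ℤ (𝓞 K) x : ℤ)^2 + d * b^2 := by
      rw [hn', ht', ← hb]; ring
    exact_mod_cast this

theorem gq_exists_int (K : Type) [Field K] [NumberField K] (x : K) (a n : ℤ)
    (h : x^2 - a * x + n = 0) : ∃ y : 𝓞 K, (y : K) = x := by
  have : IsIntegral ℤ x := by
    refine ⟨Polynomial.X^2 - Polynomial.C a * Polynomial.X + Polynomial.C n, ?_, ?_⟩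
    · monicity!
    · simp only [Polynomial.eval₂_add, Polynomial.eval₂_sub, Polynomial.eval₂_mul,
        Polynomial.eval₂_pow, Polynomial.eval₂_X, Polynomial.eval₂_C]
      simpa using h
  exact ⟨⟨x, this⟩, rfl⟩

theorem gq_discr_pair (d : ℕ) (hd : 0 < d)
    (K : Type) [Field K] [NumberField K]
    (α : K) (hα : α ^ 2 = -(d : K)) (hgen : Algebra.adjoin ℚ {α} = ⊤) (w : 𝓞 K) (s r : ℚ)
    (hw : (w : K) = r + s * α) (hs : s ≠ 0)
    (hspan : ∀ x : 𝓞 K, ∃ a b : ℤ, x = a + b * w) :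
    (NumberField.discr K : ℚ) = - 4 * d * s^2 := by
  have hli : LinearIndependent ℤ ![(1 : 𝓞 K), w] := by
    rw [LinearIndependent.pair_iff]
    intro u v h
    obtain ⟨B, h0, h1⟩ := gq_basis d hd K α hα hgen
    have hB := LinearIndependent.pair_iff.mp
      (show LinearIndependent ℚ ![(1:K), α] by
        have := B.linearIndependent
        convert this using 1
        ext i; fin_cases i <;> simp [h0, h1])
    have h' : ((u : K) + v * (r + s * α)) = 0 := by
      rw [← hw]
      have := congrArg (fun z : 𝓞 K => (z : K)) h
      simpa using this
    have := hB (u + v * r) (v * s) (by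
      simp [Algebra.smul_def]; linear_combination h')
    have hv : v = 0 := by
      have := this.2
      simpa [hs] using this
    subst hv
    simpa using this.1
  have hsp : ⊤ ≤ Submodule.span ℤ (Set.range ![(1 : 𝓞 K), w]) := by
    intro x _
    rw [Matrix.range_cons, Matrix.range_cons, Matrix.range_empty, Set.union_empty,
      Set.singleton_union, Submodule.mem_span_pair]
    obtain ⟨a, b, h⟩ := hspan x
    exact ⟨a, b, by simp [h]⟩
  have key := NumberField.discr_eq_discr K (Module.Basis.mk hli hsp)
  rw [← key, Algebra.discr_def, Matrix.det_fin_two]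
  simp only [Algebra.traceMatrix_apply, Algebra.traceForm_apply, Module.Basis.mk_apply]
  push_cast
  simp only [Algebra.coe_trace_int]
  have t1 := (gq_tr_norm d hd K α hα hgen 1 0).1
  have t2 := (gq_tr_norm d hd K α hα hgen r s).1
  have t3 := (gq_tr_norm d hd K α hα hgen (r^2 - d * s^2) (2 * r * s)).1
  have e1 : ((1 * 1 : 𝓞 K) : K) = ((1:ℚ) : K) + ((0:ℚ) : K) * α := by simp
  have e2 : ((1 * w : 𝓞 K) : K) = ((r:ℚ) : K) + ((s:ℚ) : K) * α := by simp [hw]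
  have e3 : ((w * w : 𝓞 K) : K) =
      ((r^2 - d * s^2:ℚ) : K) + ((2 * r * s:ℚ) : K) * α := by
    simp [hw]; linear_combination (s:K)^2 * hα
  rw [mul_comm w 1, e1, e2, e3, t1, t2, t3]
  ring

/-- the ramification condition -/
def GqRam (d p : ℕ) : Prop := p ∣ d ∨ (p = 2 ∧ d % 4 ≠ 3)

theorem gq_mod4 (d : ℕ) (hsf : Squarefree d) : d % 4 ≠ 0 := by
  intro h
  have : 2 * 2 ∣ d := by omega
  have := Nat.isUnit_iff.mp (hsf 2 this)
  omega

theorem gq_case_other (d : ℕ) (hd4 : d % 4 = 1 ∨ d % 4 = 2) (a b n : ℤ)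
    (h : 4 * n = a^2 + d * b^2) : 2 ∣ a ∧ 2 ∣ b := by
  obtain ⟨k, hk⟩ : ∃ k : ℤ, (d : ℤ) = 4 * k + 1 ∨ (d : ℤ) = 4 * k + 2 :=
    ⟨d / 4, by omega⟩
  have key : (a^2 + d * b^2) % 4 = 0 := by omega
  rcases Int.even_or_odd' a with ⟨u, rfl | rfl⟩ <;> rcases Int.even_or_odd' b with ⟨v, rfl | rfl⟩
  · exact ⟨⟨u, rfl⟩, ⟨v, rfl⟩⟩
  all_goals
    exfalso
    rcases hk with hk | hk <;> rw [hk] at key <;> ring_nf at key <;> omega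

theorem gq_case_three (d : ℕ) (hd4 : d % 4 = 3) (a b n : ℤ)
    (h : 4 * n = a^2 + d * b^2) : 2 ∣ a - b := by
  obtain ⟨k, hk⟩ : ∃ k : ℤ, (d : ℤ) = 4 * k + 3 := ⟨d / 4, by omega⟩
  have key : (a^2 + d * b^2) % 4 = 0 := by omega
  rcases Int.even_or_odd' a with ⟨u, rfl | rfl⟩ <;> rcases Int.even_or_odd' b with ⟨v, rfl | rfl⟩
  · omega
  · exfalso; rw [hk] at key; ring_nf at key; omega
  · exfalso; rw [hk] at key; ring_nf at key; omega
  · omega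

theorem gq_alpha_int (d : ℕ) (K : Type) [Field K] [NumberField K]
    (α : K) (hα : α ^ 2 = -(d : K)) : ∃ β : 𝓞 K, (β : K) = α :=
  gq_exists_int K α 0 d (by simp [hα])

theorem gq_omega_int (d : ℕ) (hd4 : d % 4 = 3) (K : Type) [Field K] [NumberField K]
    (α : K) (hα : α ^ 2 = -(d : K)) : ∃ w : 𝓞 K, (w : K) = (1 + α) / 2 := by
  obtain ⟨k, hk⟩ : ∃ k : ℕ, d = 4 * k + 3 := ⟨d / 4, by omega⟩
  refine gq_exists_int K _ 1 (k + 1) ?_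
  rw [hk] at hα
  push_cast at hα ⊢
  field_simp
  linear_combination hα

theorem gq_discr (d : ℕ) (hd : 0 < d) (hsf : Squarefree d)
    (K : Type) [Field K] [NumberField K]
    (α : K) (hα : α ^ 2 = -(d : K)) (hgen : Algebra.adjoin ℚ {α} = ⊤) :
    NumberField.discr K = if d % 4 = 3 then -(d : ℤ) else -(4 * d : ℤ) := by
  split_ifs with h4
  · obtain ⟨w, hw⟩ := gq_omega_int d h4 K α hα
    have := gq_discr_pair d hd K α hα hgen w (1/2) (1/2) (by rw [hw]; push_cast; ring) (by norm_num)
      (by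
        intro x
        obtain ⟨a, b, n, hx, hn, -⟩ := gq_int_coords d hd hsf K α hα hgen x
        obtain ⟨c, hc⟩ := gq_case_three d h4 a b n hn
        refine ⟨c, b, ?_⟩
        apply RingOfIntegers.ext
        have ha : (a : K) = b + 2 * c := by
          have : a = b + 2 * c := by omega
          rw [this]; push_cast; ring
        have h2 : (2 : K) ≠ 0 := two_ne_zero
        apply mul_left_cancel₀ h2
        rw [hx, ha]
        simp only [map_add, map_mul, map_intCast, hw]
        field_simp
        ring)
    have h' : (NumberField.discr K : ℚ) = ((-(d:ℤ) : ℤ) : ℚ) := by rw [this]; push_cast; ring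
    exact_mod_cast h'
  · obtain ⟨w, hw⟩ := gq_alpha_int d K α hα
    have h0 := gq_mod4 d hsf
    have := gq_discr_pair d hd K α hα hgen w 1 0 (by rw [hw]; push_cast; ring) (by norm_num)
      (by
        intro x
        obtain ⟨a, b, n, hx, hn, -⟩ := gq_int_coords d hd hsf K α hα hgen x
        obtain ⟨⟨u, rfl⟩, ⟨v, rfl⟩⟩ := gq_case_other d (by omega) a b n hn
        refine ⟨u, v, ?_⟩
        apply RingOfIntegers.ext
        have h2 : (2 : K) ≠ 0 := two_ne_zero
        apply mul_left_cancel₀ h2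
        rw [hx]
        simp only [map_add, map_mul, map_intCast, hw]
        push_cast
        ring)
    have h' : (NumberField.discr K : ℚ) = ((-(4 * d:ℤ) : ℤ) : ℚ) := by rw [this]; push_cast; ring
    exact_mod_cast h'

theorem gq_ram_iff (d : ℕ) (hd : 0 < d) (hsf : Squarefree d)
    (K : Type) [Field K] [NumberField K]
    (α : K) (hα : α ^ 2 = -(d : K)) (hgen : Algebra.adjoin ℚ {α} = ⊤) (p : ℕ) :
    p ∈ (NumberField.discr K).natAbs.primeFactors ↔ p.Prime ∧ GqRam d p := by
  have h := gq_discr d hd hsf K α hα hgen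
  have hne : (NumberField.discr K).natAbs ≠ 0 := by
    rw [Int.natAbs_ne_zero, h]; split_ifs <;> omega
  rw [Nat.mem_primeFactors_of_ne_zero hne, GqRam]
  refine and_congr_right fun hp => ?_
  rw [h]
  split_ifs with h4
  · simp [h4]
  · have : (-(4 * d : ℤ)).natAbs = 2 ^ 2 * d := by omega
    rw [this, hp.dvd_mul]
    constructor
    · rintro (h | h)
      · exact Or.inr ⟨(Nat.prime_dvd_prime_iff_eq hp Nat.prime_two).mp (hp.dvd_of_dvd_pow h), h4⟩
      · exact Or.inl h
    · rintro (h | ⟨rfl, -⟩)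
      · exact Or.inr h
      · exact Or.inl (by norm_num)

theorem gq_sq_dvd {R : Type} [CommRing R] [IsDedekindDomain R] (I J : Ideal R)
    (h : I^2 ∣ J^2) : I ∣ J := by
  classical
  by_cases hJ : J = 0
  · rw [hJ]; exact dvd_zero _
  by_cases hI : I = 0
  · subst hI
    simp only [ne_eq, OfNat.ofNat_ne_zero, not_false_eq_true, zero_pow, zero_dvd_iff] at h
    exact absurd (pow_eq_zero_iff two_ne_zero |>.mp h) hJ
  rw [UniqueFactorizationMonoid.dvd_iff_normalizedFactors_le_normalizedFactors
    (pow_ne_zero 2 hI) (pow_ne_zero 2 hJ), UniqueFactorizationMonoid.normalizedFactors_pow,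
    UniqueFactorizationMonoid.normalizedFactors_pow] at h
  rw [UniqueFactorizationMonoid.dvd_iff_normalizedFactors_le_normalizedFactors hI hJ]
  rw [Multiset.le_iff_count] at h ⊢
  intro a
  have := h a
  rw [Multiset.count_nsmul, Multiset.count_nsmul] at this
  omega

theorem gq_sq_inj {R : Type} [CommRing R] [IsDedekindDomain R] (I J : Ideal R)
    (h : I^2 = J^2) : I = J :=
  le_antisymm (Ideal.le_of_dvd (gq_sq_dvd J I h.symm.dvd)) (Ideal.le_of_dvd (gq_sq_dvd I J h.dvd))

theorem gq_span_sq {R : Type} [CommRing R] (p x e : R) (hx : x^2 = p * e)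
    (h : ∃ u v w : R, u * p + v * x + w * e = 1) :
    (Ideal.span {p, x})^2 = Ideal.span {p} := by
  obtain ⟨u, v, w, h⟩ := h
  rw [pow_two, Ideal.span_pair_mul_span_pair]
  apply le_antisymm
  · rw [Ideal.span_le]
    intro y hy
    simp only [Set.mem_insert_iff, Set.mem_singleton_iff] at hy
    rw [SetLike.mem_coe, Ideal.mem_span_singleton]
    rcases hy with rfl | rfl | rfl | rfl
    · exact ⟨p, rfl⟩
    · exact ⟨x, rfl⟩
    · exact ⟨x, mul_comm _ _⟩
    · exact ⟨e, by rw [← hx]; ring⟩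
  · rw [Ideal.span_le, Set.singleton_subset_iff, SetLike.mem_coe]
    have : p = u * (p * p) + v * (p * x) + w * (x * x) := by
      linear_combination (-p) * h - w * hx
    have key : u * (p * p) + v * (p * x) + w * (x * x) ∈
        Ideal.span {p * p, p * x, x * p, x * x} := by
      refine add_mem (add_mem ?_ ?_) ?_ <;> apply Ideal.mul_mem_left <;>
        apply Ideal.subset_span <;> simp
    rwa [← this] at key

theorem gq_ram_exists (d : ℕ) (hd : 0 < d) (hsf : Squarefree d)
    (K : Type) [Field K] [NumberField K]
    (α : K) (hα : α ^ 2 = -(d : K)) (p : ℕ) (hp : p.Prime) (hr : GqRam d p) :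
    ∃ P : Ideal (𝓞 K), P ^ 2 = Ideal.span {(p : 𝓞 K)} := by
  obtain ⟨β, hβ⟩ := gq_alpha_int d K α hα
  have hβ2 : β^2 = -(d : 𝓞 K) := by
    apply RingOfIntegers.ext
    simpa [hβ] using hα
  by_cases hpd : p ∣ d
  · obtain ⟨e, rfl⟩ := hpd
    refine ⟨_, gq_span_sq (p : 𝓞 K) β (-(e : 𝓞 K)) (by rw [hβ2]; push_cast; ring) ?_⟩
    have hc : Nat.Coprime p e := Nat.coprime_of_squarefree_mul hsf
    have := Nat.isCoprime_iff_coprime.mpr hc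
    obtain ⟨u, v, huv⟩ := this
    refine ⟨u, 0, -v, ?_⟩
    have h2 := congrArg (fun z : ℤ => (z : 𝓞 K)) huv
    push_cast at h2
    linear_combination h2
  · obtain ⟨rfl, h4⟩ := hr.resolve_left hpd
    obtain ⟨k, rfl⟩ : ∃ k : ℕ, d = 4 * k + 1 := ⟨d / 4, by omega⟩
    refine ⟨_, gq_span_sq ((2 : ℕ) : 𝓞 K) (1 + β) (β - 2 * k) ?_ ?_⟩
    · push_cast at hβ2 ⊢
      linear_combination hβ2
    · refine ⟨-k, 1, -1, ?_⟩
      push_cast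
      ring

theorem gq_unram (d : ℕ) (hd : 0 < d) (hsf : Squarefree d)
    (K : Type) [Field K] [NumberField K]
    (α : K) (hα : α ^ 2 = -(d : K)) (hgen : Algebra.adjoin ℚ {α} = ⊤)
    (p : ℕ) (hp : p.Prime) (hr : ¬ GqRam d p) (x : 𝓞 K) (hx : (p : 𝓞 K) ∣ x^2) :
    (p : 𝓞 K) ∣ x := by
  obtain ⟨β, hβ⟩ := gq_alpha_int d K α hα
  have hpd : ¬ p ∣ d := fun h => hr (Or.inl h)
  have hpZ : Prime (p : ℤ) := Nat.prime_iff_prime_int.mp hp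
  obtain ⟨a, b, n, hab, hn, hN⟩ := gq_int_coords d hd hsf K α hα hgen x
  obtain ⟨y, hy⟩ := hx
  obtain ⟨a', b', n', hab', hn', hN'⟩ := gq_int_coords d hd hsf K α hα hgen y
  have hpn : (p : ℤ) ∣ n := by
    have h1 : Algebra.norm ℤ (x^2) = n^2 := by rw [map_pow, hN]
    have h2 : Algebra.norm ℤ ((p : 𝓞 K) * y) = p^2 * n' := by
      rw [map_mul, hN']
      congr 1
      have : ((p:ℕ) : 𝓞 K) = algebraMap ℤ (𝓞 K) p := by simp
      rw [this, Algebra.norm_algebraMap, RingOfIntegers.rank]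
      congr 1
      obtain ⟨B, -, -⟩ := gq_basis d hd K α hα hgen
      rw [Module.finrank_eq_card_basis B]; simp
    rw [hy, h2] at h1
    exact hpZ.dvd_of_dvd_pow (n := 2) ⟨p * n', by rw [← h1]; ring⟩
  -- x^2 = a x - n
  have hq : x^2 = a * x - n := by
    apply RingOfIntegers.ext
    simp only [map_pow, map_sub, map_mul, map_intCast]
    have h4 : (4 : K) * n = a^2 + d * b^2 := by exact_mod_cast congrArg (fun z : ℤ => (z:K)) hn
    have : (4:K) ≠ 0 := by norm_num
    apply mul_left_cancel₀ this
    linear_combination (2 * (x:K) + a + b * α - 2 * a) * hab + b^2 * hα + h4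
  -- coordinates of x^2 = p y, so a * (a,b) - 2 n = p (a', b')
  have hcoord : ((a : K) * (a + b * α) - 2 * n) = p * (a' + b' * α) := by
    rw [← hab, ← hab']
    have := congrArg (fun z : 𝓞 K => (z : K)) (hq.symm.trans hy)
    simp only [map_sub, map_mul, map_intCast, map_natCast] at this
    linear_combination 2 * this
  have hpa : (p : ℤ) ∣ a := by
    obtain ⟨B, h0, h1⟩ := gq_basis d hd K α hα hgen
    have t1 := (gq_tr_norm d hd K α hα hgen (a*a - 2 * n) (a * b)).1
    have t2 := (gq_tr_norm d hd K α hα hgen (p * a') (p * b')).1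
    have e : (((a*a - 2 * n : ℚ) : K) + ((a * b : ℚ) : K) * α) =
        (((p * a' : ℚ) : K) + ((p * b' : ℚ) : K) * α) := by
      push_cast; linear_combination hcoord
    rw [e, t2] at t1
    have t3 : (p : ℤ) * a' = a * a - 2 * n := by
      have : (p : ℚ) * a' = a * a - 2 * n := by linarith
      exact_mod_cast this
    have : (p : ℤ) ∣ a * a := by
      have : a * a = p * a' + 2 * n := by omega
      rw [this]
      exact dvd_add (Dvd.intro _ rfl) (hpn.mul_left 2)
    exact (hpZ.dvd_mul.mp this).elim id id
  obtain ⟨n1, rfl⟩ := hpn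
  obtain ⟨a1, rfl⟩ := hpa
  have hpb : (p : ℤ) ∣ b := by
    by_cases hp2 : p = 2
    · subst hp2
      by_contra hb
      obtain ⟨v, rfl⟩ : ∃ v, b = 2 * v + 1 := ⟨b / 2, by omega⟩
      obtain ⟨k, hk⟩ : ∃ k : ℤ, (d : ℤ) = 2 * k + 1 := ⟨d / 2, by omega⟩
      have : (4 * ((2:ℕ) * n1) : ℤ) % 2 = 0 := by omega
      rw [hn, hk] at this
      push_cast at this
      ring_nf at this
      omega
    · have : (p : ℤ) ∣ d * b^2 := by
        have e : (d : ℤ) * b^2 = p * (4 * n1 - p * a1^2) := by linear_combination -hn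
        exact ⟨_, e⟩
      rcases hpZ.dvd_mul.mp this with h | h
      · exact absurd (by exact_mod_cast h) hpd
      · exact hpZ.dvd_of_dvd_pow h
  obtain ⟨b1, rfl⟩ := hpb
  by_cases hp2 : p = 2
  · subst hp2
    have h4 : d % 4 = 3 := by
      by_contra h; exact hr (Or.inr ⟨rfl, h⟩)
    obtain ⟨w, hw⟩ := gq_omega_int d h4 K α hα
    obtain ⟨k, hk⟩ : ∃ k : ℤ, (d : ℤ) = 2 * k + 1 := ⟨d / 2, by omega⟩
    obtain ⟨c, hc⟩ : (2 : ℤ) ∣ a1 - b1 := by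
      have h5 : 2 * n1 = a1^2 + d * b1^2 := by
        push_cast at hn; linarith
      have : (a1^2 + d * b1^2) % 2 = 0 := by omega
      rw [hk] at this
      rcases Int.even_or_odd' a1 with ⟨u, rfl | rfl⟩ <;>
        rcases Int.even_or_odd' b1 with ⟨v, rfl | rfl⟩
      · omega
      · exfalso; ring_nf at this; omega
      · exfalso; ring_nf at this; omega
      · omega
    refine ⟨c + b1 * w, ?_⟩
    apply RingOfIntegers.ext
    have h2 : (2 : K) ≠ 0 := two_ne_zero
    apply mul_left_cancel₀ h2
    rw [hab]
    have ha : (a1 : K) = b1 + 2 * c := by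
      have : a1 = b1 + 2 * c := by omega
      rw [this]; push_cast; ring
    simp only [map_add, map_mul, map_intCast, map_natCast, hw]
    push_cast
    rw [ha]
    field_simp
    ring
  · have hodd : IsCoprime (p : ℤ) 2 := by
      rw [show (2:ℤ) = ((2:ℕ):ℤ) by rfl, Nat.isCoprime_iff_coprime]
      exact (Nat.coprime_primes hp Nat.prime_two).mpr hp2
    obtain ⟨u, v, huv⟩ := hodd
    refine ⟨u * x + v * (a1 + b1 * β), ?_⟩
    apply RingOfIntegers.ext
    simp only [map_add, map_mul, map_intCast, map_natCast, hβ]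
    have h2 : (u : K) * p + v * 2 = 1 := by
      exact_mod_cast congrArg (fun z : ℤ => (z : K)) huv
    push_cast at hab
    linear_combination -(x:K) * h2 + v * hab

theorem gq_norm_nat (d : ℕ) (hd : 0 < d)
    (K : Type) [Field K] [NumberField K]
    (α : K) (hα : α ^ 2 = -(d : K)) (hgen : Algebra.adjoin ℚ {α} = ⊤) (m : ℕ) :
    Algebra.norm ℤ (m : 𝓞 K) = (m:ℤ)^2 := by
  have hr : Module.finrank ℚ K = 2 := by
    obtain ⟨B, -, -⟩ := gq_basis d hd K α hα hgen
    rw [Module.finrank_eq_card_basis B]; simp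
  have : ((m:ℕ) : 𝓞 K) = algebraMap ℤ (𝓞 K) m := by simp
  rw [this, Algebra.norm_algebraMap, RingOfIntegers.rank, hr]

theorem gq_quad (d : ℕ) (hd : 0 < d) (hsf : Squarefree d)
    (K : Type) [Field K] [NumberField K]
    (α : K) (hα : α ^ 2 = -(d : K)) (hgen : Algebra.adjoin ℚ {α} = ⊤) (x : 𝓞 K) :
    ∃ a b n : ℤ, 2 * (x : K) = a + b * α ∧ 4 * n = a^2 + d * b^2 ∧ Algebra.norm ℤ x = n ∧
      0 ≤ n ∧ x^2 = a * x - n := by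
  obtain ⟨a, b, n, hab, hn, hN⟩ := gq_int_coords d hd hsf K α hα hgen x
  refine ⟨a, b, n, hab, hn, hN, by nlinarith [sq_nonneg a, sq_nonneg b], ?_⟩
  apply RingOfIntegers.ext
  simp only [map_pow, map_sub, map_mul, map_intCast]
  have h4 : (4 : K) * n = a^2 + d * b^2 := by exact_mod_cast congrArg (fun z : ℤ => (z:K)) hn
  have : (4:K) ≠ 0 := by norm_num
  apply mul_left_cancel₀ this
  linear_combination (2 * (x:K) + a + b * α - 2 * a) * hab + b^2 * hα + h4

theorem gq_unit (d : ℕ) (hd : 0 < d) (hsf : Squarefree d) (hd1 : d ≠ 1) (hd3 : d ≠ 3)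
    (K : Type) [Field K] [NumberField K]
    (α : K) (hα : α ^ 2 = -(d : K)) (hgen : Algebra.adjoin ℚ {α} = ⊤) (e : 𝓞 K) (he : IsUnit e) :
    e = 1 ∨ e = -1 := by
  obtain ⟨a, b, n, hab, hn, hN, hn0, hq⟩ := gq_quad d hd hsf K α hα hgen e
  have h1 : IsUnit n := by rw [← hN]; exact he.map _
  have hn1 : n = 1 := by
    rcases Int.isUnit_iff.mp h1 with h | h <;> omega
  subst hn1
  have h4 := gq_mod4 d hsf
  have hb : b = 0 := by
    by_contra hb
    have hb1 : 1 ≤ b^2 := by have := sq_pos_of_ne_zero hb; omega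
    by_cases hd2 : d = 2
    · subst hd2
      push_cast at hn
      have : b^2 ≤ 2 := by nlinarith [sq_nonneg a]
      have hb2 : b ≤ 1 := by nlinarith
      have hb3 : -1 ≤ b := by nlinarith
      have ha1 : a ≤ 2 := by nlinarith
      have ha2 : -2 ≤ a := by nlinarith
      interval_cases b <;> interval_cases a <;> omega
    · have : (5:ℤ) ≤ d := by omega
      nlinarith [sq_nonneg a]
  subst hb
  have ha : (a - 2) * (a + 2) = 0 := by linear_combination -hn
  have h2 : (2 : K) ≠ 0 := two_ne_zero
  rcases mul_eq_zero.mp ha with h | h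
  · left
    have : a = 2 := by omega
    subst this
    apply RingOfIntegers.ext
    apply mul_left_cancel₀ h2
    rw [hab]; simp
  · right
    have : a = -2 := by omega
    subst this
    apply RingOfIntegers.ext
    apply mul_left_cancel₀ h2
    rw [hab]; simp

theorem gq_kernel (d : ℕ) (hd : 0 < d) (hsf : Squarefree d) (hd1 : d ≠ 1) (hd3 : d ≠ 3)
    (K : Type) [Field K] [NumberField K]
    (α : K) (hα : α ^ 2 = -(d : K)) (hgen : Algebra.adjoin ℚ {α} = ⊤) (m : ℕ)
    (hm : Squarefree m) (y : 𝓞 K) (hy : (Ideal.span {y})^2 = Ideal.span {(m : 𝓞 K)}) :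
    m = 1 ∨ m = d := by
  have hm0 : m ≠ 0 := hm.ne_zero
  have hmR : (m : 𝓞 K) ≠ 0 := by exact_mod_cast hm0
  rw [Ideal.span_singleton_pow, Ideal.span_singleton_eq_span_singleton] at hy
  obtain ⟨e, he⟩ := hy.symm
  obtain ⟨a, b, n, hab, hn, hN, hn0, hq⟩ := gq_quad d hd hsf K α hα hgen y
  have hnm : n = m := by
    have h1 : Algebra.norm ℤ (y^2) = n^2 := by rw [map_pow, hN]
    have hr : Module.finrank ℚ K = 2 := by
      obtain ⟨B, -, -⟩ := gq_basis d hd K α hα hgen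
      rw [Module.finrank_eq_card_basis B]; simp
    have h2 : Algebra.norm ℤ (m : 𝓞 K) = (m:ℤ)^2 := by
      have : ((m:ℕ) : 𝓞 K) = algebraMap ℤ (𝓞 K) m := by simp
      rw [this, Algebra.norm_algebraMap, RingOfIntegers.rank, hr]
    rw [← he, map_mul, h2] at h1
    obtain ⟨_, _, k, _, _, hk, hk0, _⟩ := gq_quad d hd hsf K α hα hgen (e : 𝓞 K)
    have hu : IsUnit (Algebra.norm ℤ (e : 𝓞 K)) := e.isUnit.map _
    have : k = 1 := by
      rw [hk] at hu
      rcases Int.isUnit_iff.mp hu with h | h <;> omega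
    rw [hk, this, mul_one] at h1
    have hmn : (0:ℤ) ≤ m := by positivity
    nlinarith [pow_left_inj₀ hmn hn0 (two_ne_zero) |>.mp h1]
  subst hnm
  rcases gq_unit d hd hsf hd1 hd3 K α hα hgen e e.isUnit with h | h
  · rw [h, mul_one] at he
    left
    rw [← he] at hq
    have h1 : (a : 𝓞 K) * y = 2 * m := by push_cast at hq; linear_combination -hq
    have h2 : ((a^2 : ℤ) : 𝓞 K) = ((4 * m : ℤ) : 𝓞 K) := by
      apply mul_right_cancel₀ hmR
      push_cast
      linear_combination (a * y + 2 * m) * h1 + a^2 * he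
    have h3 : a^2 = 4 * m := by exact_mod_cast h2
    obtain ⟨u, rfl⟩ : (2:ℤ) ∣ a := by
      apply Int.prime_two.dvd_of_dvd_pow (n := 2); omega
    have h4 : u.natAbs * u.natAbs ∣ m := by
      have : (u * u) = m := by nlinarith
      rw [← Int.natAbs_mul, this]; simp
    have := Nat.isUnit_iff.mp (hm _ h4)
    have hu : u * u = 1 := by rcases Int.natAbs_eq u with h | h <;> rw [this] at h <;> rw [h] <;> rfl
    have : (m : ℤ) = 1 := by nlinarith
    exact_mod_cast this
  · rw [h] at he
    right
    have hay : (a : 𝓞 K) * y = 0 := by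
      push_cast at hq; linear_combination -hq - he
    have hy0 : y ≠ 0 := by
      rintro rfl
      apply hmR
      linear_combination -he
    have ha : a = 0 := by
      have := (mul_eq_zero.mp hay).resolve_right hy0
      exact_mod_cast this
    subst ha
    have hb : (2:ℤ) ∣ b := by
      by_contra hb
      obtain ⟨v, rfl⟩ : ∃ v, b = 2 * v + 1 := ⟨b / 2, by omega⟩
      have h4 := gq_mod4 d hsf
      have : (d : ℤ) = 4 * (m - d * (v^2 + v)) := by linear_combination -hn
      omega
    obtain ⟨v, rfl⟩ := hb
    have h3 : (m : ℤ) = d * (v * v) := by linarith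
    have h4 : v.natAbs * v.natAbs ∣ m := by
      refine ⟨d, ?_⟩
      have := congrArg Int.natAbs h3
      rw [Int.natAbs_mul, Int.natAbs_mul] at this
      simp at this
      rw [this]; ring
    have := Nat.isUnit_iff.mp (hm _ h4)
    have hu : v * v = 1 := by rcases Int.natAbs_eq v with h | h <;> rw [this] at h <;> rw [h] <;> rfl
    rw [hu, mul_one] at h3
    exact_mod_cast h3

open Classical in
/-- class of an ideal, junk value `1` at zero -/
noncomputable def gqCls {R : Type} [CommRing R] [IsDedekindDomain R] (I : Ideal R) :
    ClassGroup R :=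
  if h : I = 0 then 1 else ClassGroup.mk0 ⟨I, mem_nonZeroDivisors_of_ne_zero h⟩

theorem gqCls_mul {R : Type} [CommRing R] [IsDedekindDomain R] (I J : Ideal R) (hI : I ≠ 0)
    (hJ : J ≠ 0) : gqCls (I * J) = gqCls I * gqCls J := by
  rw [gqCls, gqCls, gqCls, dif_neg hI, dif_neg hJ, dif_neg (mul_ne_zero hI hJ), ← map_mul]
  rfl

theorem gqCls_eq_one {R : Type} [CommRing R] [IsDedekindDomain R] (I : Ideal R) (hI : I ≠ 0) :
    gqCls I = 1 ↔ ∃ y, I = Ideal.span {y} := by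
  rw [gqCls, dif_neg hI, ClassGroup.mk0_eq_one_iff]
  exact ⟨fun h => h.1, fun h => ⟨h⟩⟩

theorem gqCls_surj {R : Type} [CommRing R] [IsDedekindDomain R] (c : ClassGroup R) :
    ∃ I : Ideal R, I ≠ 0 ∧ gqCls I = c := by
  obtain ⟨I, rfl⟩ := ClassGroup.mk0_surjective c
  have h : (I : Ideal R) ≠ 0 := nonZeroDivisors.ne_zero I.2
  exact ⟨I, h, by rw [gqCls, dif_neg h]⟩

theorem gq_reduce {R : Type} [CommRing R] [IsDedekindDomain R] [CharZero R] (J : Ideal R) (k : ℕ)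
    (hk : k ≠ 0) (h : J^2 = Ideal.span {(k : R)}) :
    ∃ (J' : Ideal R) (m : ℕ), Squarefree m ∧ J'^2 = Ideal.span {(m : R)} ∧ gqCls J' = gqCls J := by
  obtain ⟨m, b, rfl, hm⟩ := Nat.sq_mul_squarefree k
  have hb : b ≠ 0 := by rintro rfl; simp at hk
  have hbR : (Ideal.span {(b : R)} : Ideal R) ≠ 0 := by
    simpa [Ideal.zero_eq_bot, Ideal.span_singleton_eq_bot] using hb
  have hm0 : m ≠ 0 := hm.ne_zero
  have hmul : (Ideal.span {((b^2 * m : ℕ) : R)} : Ideal R) =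
      (Ideal.span {(b : R)})^2 * Ideal.span {(m : R)} := by
    rw [Ideal.span_singleton_pow, Ideal.span_singleton_mul_span_singleton]; push_cast; rfl
  obtain ⟨J', rfl⟩ : Ideal.span {(b : R)} ∣ J := gq_sq_dvd _ _ (by rw [h, hmul]; exact Dvd.intro _ rfl)
  rw [hmul, mul_pow] at h
  have h' := mul_left_cancel₀ (pow_ne_zero 2 hbR) h
  have hJ' : J' ≠ 0 := by
    rintro rfl
    rw [zero_pow two_ne_zero] at h'
    have := h'.symm
    rw [Ideal.zero_eq_bot, Ideal.span_singleton_eq_bot] at this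
    exact hm0 (by exact_mod_cast this)
  refine ⟨J', m, hm, h', ?_⟩
  rw [gqCls_mul _ _ hbR hJ', (gqCls_eq_one _ hbR).mpr ⟨_, rfl⟩, one_mul]

theorem gq_surj (d : ℕ) (hd : 0 < d) (hsf : Squarefree d)
    (K : Type) [Field K] [NumberField K]
    (α : K) (hα : α ^ 2 = -(d : K)) (hgen : Algebra.adjoin ℚ {α} = ⊤)
    (c : ClassGroup (𝓞 K)) (hc : c^2 = 1) :
    ∃ (J : Ideal (𝓞 K)) (m : ℕ), Squarefree m ∧ J^2 = Ideal.span {(m : 𝓞 K)} ∧ gqCls J = c := by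
  obtain ⟨I, hI, rfl⟩ := gqCls_surj c
  rw [pow_two, ← gqCls_mul I I hI hI, gqCls_eq_one _ (mul_ne_zero hI hI)] at hc
  obtain ⟨y, hy⟩ := hc
  suffices h : ∃ (J : Ideal (𝓞 K)) (c : ℤ), c ≠ 0 ∧ J^2 = Ideal.span {(c : 𝓞 K)} ∧
      gqCls J = gqCls I by
    obtain ⟨J, c, hc0, hJ, hcls⟩ := h
    obtain ⟨J', m, hm, hJ', hcls'⟩ := gq_reduce J c.natAbs (by omega) (by
      rw [hJ]
      rcases Int.natAbs_eq c with h | h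
      · conv_lhs => rw [h]
        simp
      · conv_lhs => rw [h]
        rw [Int.cast_neg, Ideal.span_singleton_neg, Int.cast_natCast])
    exact ⟨J', m, hm, hJ', hcls'.trans hcls⟩
  obtain ⟨a, b, n, hab, hn, hN, hn0, hq⟩ := gq_quad d hd hsf K α hα hgen y
  have hn' : n = (Ideal.absNorm I : ℤ)^2 := by
    have h1 := congrArg Ideal.absNorm hy
    rw [Ideal.absNorm_span_singleton, map_mul, hN] at h1
    have : (n.natAbs : ℤ) = n := Int.natAbs_of_nonneg hn0
    rw [← this, ← h1]; push_cast; ring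
  have hI0 : (Ideal.absNorm I : ℤ) ≠ 0 := by
    have := Ideal.absNorm_eq_zero_iff.not.mpr hI
    exact_mod_cast this
  set k : ℤ := (Ideal.absNorm I : ℤ) with hk
  rw [hn'] at hq
  push_cast at hq
  by_cases hc0 : a + 2 * k = 0
  · refine ⟨I, -k, by simpa using hI0, ?_, rfl⟩
    have hw : (k + y)^2 = 0 := by
      have : ((a : ℤ) : 𝓞 K) + 2 * (k : 𝓞 K) = 0 := by exact_mod_cast congrArg (Int.cast : ℤ → 𝓞 K) hc0
      linear_combination hq + y * this
    have hw' := pow_eq_zero_iff two_ne_zero |>.mp hw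
    have : y = ((-k : ℤ) : 𝓞 K) := by push_cast; linear_combination hw'
    rw [pow_two, hy, this]
  · have hw : (k + y)^2 = y * ((a + 2 * k : ℤ) : 𝓞 K) := by
      push_cast; linear_combination hq
    have hs : (Ideal.span {(k : 𝓞 K) + y})^2 = I^2 * Ideal.span {((a + 2 * k : ℤ) : 𝓞 K)} := by
      rw [pow_two I, hy, Ideal.span_singleton_pow, hw, Ideal.span_singleton_mul_span_singleton]
    obtain ⟨J, hJ⟩ : I ∣ Ideal.span {(k : 𝓞 K) + y} := gq_sq_dvd _ _ (Dvd.intro _ hs.symm)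
    have hJ2 : J^2 = Ideal.span {((a + 2 * k : ℤ) : 𝓞 K)} := by
      rw [hJ, mul_pow] at hs
      exact mul_left_cancel₀ (pow_ne_zero 2 hI) hs
    have hJ0 : J ≠ 0 := by
      rintro rfl
      rw [zero_pow two_ne_zero] at hJ2
      have := hJ2.symm
      rw [Ideal.zero_eq_bot, Ideal.span_singleton_eq_bot] at this
      exact hc0 (by exact_mod_cast this)
    refine ⟨J, a + 2 * k, hc0, hJ2, ?_⟩
    have h1 : gqCls I * gqCls J = 1 := by
      rw [← gqCls_mul _ _ hI hJ0, gqCls_eq_one _ (mul_ne_zero hI hJ0)]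
      exact ⟨_, hJ.symm⟩
    have h2 : gqCls I * gqCls I = 1 := by
      rw [← gqCls_mul _ _ hI hI, gqCls_eq_one _ (mul_ne_zero hI hI)]
      exact ⟨_, hy⟩
    exact mul_left_cancel (h1.trans h2.symm)

theorem gq_ram_of_sq (d : ℕ) (hd : 0 < d) (hsf : Squarefree d)
    (K : Type) [Field K] [NumberField K]
    (α : K) (hα : α ^ 2 = -(d : K)) (hgen : Algebra.adjoin ℚ {α} = ⊤)
    (J : Ideal (𝓞 K)) (m : ℕ) (hm : Squarefree m) (hJ : J^2 = Ideal.span {(m : 𝓞 K)})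
    (p : ℕ) (hp : p.Prime) (hpm : p ∣ m) : GqRam d p := by
  by_contra hr
  obtain ⟨q, rfl⟩ := hpm
  have hle : J ≤ Ideal.span {(p : 𝓞 K)} := by
    intro x hx
    rw [Ideal.mem_span_singleton]
    apply gq_unram d hd hsf K α hα hgen p hp hr
    have : x^2 ∈ J^2 := Ideal.pow_mem_pow hx 2
    rw [hJ, Ideal.mem_span_singleton] at this
    exact dvd_trans (by push_cast; exact Dvd.intro _ rfl) this
  obtain ⟨L, rfl⟩ := Ideal.dvd_iff_le.mpr hle
  have hpR : (Ideal.span {(p : 𝓞 K)} : Ideal (𝓞 K)) ≠ 0 := by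
    simpa [Ideal.zero_eq_bot, Ideal.span_singleton_eq_bot] using hp.ne_zero
  have hpR' : (p : 𝓞 K) ≠ 0 := by exact_mod_cast hp.ne_zero
  rw [mul_pow, Ideal.span_singleton_pow] at hJ
  have hdvd : Ideal.span {(p : 𝓞 K)^2} ∣ Ideal.span {((p * q : ℕ) : 𝓞 K)} := Dvd.intro _ hJ
  rw [Ideal.dvd_span_singleton, Ideal.mem_span_singleton] at hdvd
  have h2 : Algebra.norm ℤ ((p : 𝓞 K)^2) ∣ Algebra.norm ℤ (((p * q : ℕ) : 𝓞 K)) :=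
    map_dvd _ hdvd
  rw [map_pow, gq_norm_nat d hd K α hα hgen, gq_norm_nat d hd K α hα hgen] at h2
  have h3 : (p^2)^2 ∣ (p * q)^2 := by exact_mod_cast h2
  have h4 : p * p ∣ p * q := by
    rw [← pow_two]
    exact (Nat.pow_dvd_pow_iff two_ne_zero).mp h3
  exact hp.ne_one (Nat.isUnit_iff.mp (hm _ h4))

theorem gq_prod_symmDiff {G : Type} [CommGroup G] (g : ℕ → G) (T U S : Finset ℕ)
    (hT : T ⊆ S) (hg : ∀ p ∈ S, g p ^ 2 = 1) :
    ∏ p ∈ symmDiff T U, g p = (∏ p ∈ T, g p) * ∏ p ∈ U, g p := by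
  have h1 : symmDiff T U = (T \ U) ∪ (U \ T) := rfl
  rw [h1, Finset.prod_union (disjoint_sdiff_sdiff), ← Finset.prod_inter_mul_prod_diff T U g,
    ← Finset.prod_inter_mul_prod_diff U T g, Finset.inter_comm U T]
  have h2 : (∏ p ∈ T ∩ U, g p) * (∏ p ∈ T ∩ U, g p) = 1 := by
    rw [← Finset.prod_mul_distrib]
    apply Finset.prod_eq_one
    intro p hp
    rw [← pow_two]
    exact hg p (hT (Finset.mem_inter.mp hp).1)
  calc _ = ((∏ p ∈ T ∩ U, g p) * (∏ p ∈ T ∩ U, g p)) *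
      ((∏ x ∈ T \ U, g x) * ∏ x ∈ U \ T, g x) := by rw [h2, one_mul]
    _ = _ := by
      simp only [mul_comm, mul_left_comm, mul_assoc]

/-- counting -/
theorem gq_count {G : Type} [CommGroup G] [Finite G] (g : ℕ → G) (S S0 : Finset ℕ)
    (hS0 : S0 ⊆ S) (hne : S0.Nonempty) (hg : ∀ p ∈ S, g p ^ 2 = 1)
    (hsurj : ∀ c : G, c^2 = 1 → ∃ T ⊆ S, ∏ p ∈ T, g p = c)
    (hker : ∀ T ⊆ S, (∏ p ∈ T, g p = 1 ↔ T = ∅ ∨ T = S0)) :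
    Nat.card {x : G // x^2 = 1} = 2 ^ (S.card - 1) := by
  classical
  have := Fintype.ofFinite G
  rw [Nat.card_eq_fintype_card, Fintype.card_subtype]
  have hmaps : Set.MapsTo (fun T : Finset ℕ => ∏ p ∈ T, g p) (S.powerset : Set (Finset ℕ))
      (Finset.univ.filter (fun x : G => x^2 = 1) : Finset G) := by
    intro T hT
    simp only [Finset.coe_powerset, Set.mem_preimage, Set.mem_powerset_iff, Finset.coe_subset] at hT
    simp only [Finset.coe_filter, Finset.mem_univ, true_and, Set.mem_setOf_eq]
    rw [← Finset.prod_pow]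
    exact Finset.prod_eq_one fun p hp => hg p (hT hp)
  have h := Finset.card_eq_sum_card_fiberwise hmaps
  rw [Finset.sum_const_nat (m := 2), Finset.card_powerset] at h
  · have hpos : S.card ≠ 0 := by
      obtain ⟨x, hx⟩ := hne
      exact Finset.card_ne_zero_of_mem (hS0 hx)
    obtain ⟨k, hk⟩ := Nat.exists_eq_succ_of_ne_zero hpos
    rw [hk, pow_succ] at h
    rw [hk, Nat.succ_sub_one]
    exact (Nat.eq_of_mul_eq_mul_right two_pos h).symm
  · intro c hc
    obtain ⟨T, hT, rfl⟩ := hsurj c (by simpa using hc)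
    have : (S.powerset.filter fun U => ∏ p ∈ U, g p = ∏ p ∈ T, g p) = {T, symmDiff T S0} := by
      ext U
      simp only [Finset.mem_filter, Finset.mem_powerset, Finset.mem_insert, Finset.mem_singleton]
      have key : ∀ U ⊆ S, (∏ p ∈ U, g p = ∏ p ∈ T, g p ↔ U = T ∨ U = symmDiff T S0) := by
        intro U hU
        have hsub : symmDiff T U ⊆ S := by
          intro x hx
          rcases Finset.mem_symmDiff.mp hx with h | h
          · exact hT h.1
          · exact hU h.1
        have hk := hker _ hsub
        rw [gq_prod_symmDiff g T U S hT hg] at hk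
        have hTT : (∏ p ∈ T, g p) * (∏ p ∈ T, g p) = 1 := by
          rw [← pow_two, ← Finset.prod_pow]
          exact Finset.prod_eq_one fun p hp => hg p (hT hp)
        constructor
        · intro h
          rw [h] at hk
          rcases hk.mp hTT with h | h
          · left; exact (symmDiff_eq_bot.mp h).symm
          · right; rw [← h, symmDiff_symmDiff_cancel_left]
        · intro h
          apply mul_left_cancel (a := ∏ p ∈ T, g p)
          rw [hTT, hk]
          rcases h with rfl | rfl
          · left; exact symmDiff_self _
          · right; rw [symmDiff_symmDiff_cancel_left]
      constructor
      · rintro ⟨hU, h⟩; exact (key U hU).mp h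
      · intro h
        have hU : U ⊆ S := by
          rcases h with rfl | rfl
          · exact hT
          · intro x hx
            rcases Finset.mem_symmDiff.mp hx with h | h
            · exact hT h.1
            · exact hS0 h.1
        exact ⟨hU, (key U hU).mpr h⟩
    rw [this]
    apply Finset.card_pair
    intro h
    have h' : symmDiff T T = symmDiff T (symmDiff T S0) := by rw [← h]
    rw [symmDiff_self, symmDiff_symmDiff_cancel_left] at h'
    exact hne.ne_empty h'.symm

theorem gqCls_prod {R : Type} [CommRing R] [IsDedekindDomain R] (P : ℕ → Ideal R) (T : Finset ℕ)
    (hP : ∀ p ∈ T, P p ≠ 0) :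
    ∏ p ∈ T, P p ≠ 0 ∧ gqCls (∏ p ∈ T, P p) = ∏ p ∈ T, gqCls (P p) := by
  classical
  induction T using Finset.induction_on with
  | empty =>
    refine ⟨by simp, ?_⟩
    simp only [Finset.prod_empty]
    rw [gqCls_eq_one _ one_ne_zero]
    exact ⟨1, by simp⟩
  | insert p T hp ih =>
    have ih' := ih (fun q hq => hP q (Finset.mem_insert_of_mem hq))
    have h0 := hP p (Finset.mem_insert_self _ _)
    rw [Finset.prod_insert hp, Finset.prod_insert hp]
    exact ⟨mul_ne_zero h0 ih'.1, by rw [gqCls_mul _ _ h0 ih'.1, ih'.2]⟩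

theorem two_torsion_classGroup_imaginary_quadratic
    (d : ℕ) (hd : 0 < d) (hsf : Squarefree d)
    (K : Type) [Field K] [NumberField K]
    (α : K) (hα : α ^ 2 = -(d : K)) (hgen : Algebra.adjoin ℚ {α} = ⊤) :
    Nat.card {x : ClassGroup (𝓞 K) // x ^ 2 = 1} =
      2 ^ ((NumberField.discr K).natAbs.primeFactors.card - 1) := by
  classical
  have hram := gq_ram_iff d hd hsf K α hα hgen
  set S := (NumberField.discr K).natAbs.primeFactors with hS
  have hex : ∀ p : ℕ, ∃ P : Ideal (𝓞 K), p ∈ S → P ^ 2 = Ideal.span {(p : 𝓞 K)} := by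
    intro p
    by_cases hp : p ∈ S
    · obtain ⟨P, hP⟩ := gq_ram_exists d hd hsf K α hα p ((hram p).mp hp).1 ((hram p).mp hp).2
      exact ⟨P, fun _ => hP⟩
    · exact ⟨⊤, fun h => absurd h hp⟩
  choose P hP using hex
  have hP0 : ∀ p ∈ S, P p ≠ 0 := by
    intro p hp h
    have h1 := hP p hp
    rw [h, zero_pow two_ne_zero] at h1
    have := h1.symm
    rw [Ideal.zero_eq_bot, Ideal.span_singleton_eq_bot] at this
    exact ((hram p).mp hp).1.ne_zero (by exact_mod_cast this)
  have hcls : ∀ T ⊆ S, ∏ p ∈ T, P p ≠ 0 ∧ gqCls (∏ p ∈ T, P p) = ∏ p ∈ T, gqCls (P p) :=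
    fun T hT => gqCls_prod P T fun p hp => hP0 p (hT hp)
  have hsq : ∀ T ⊆ S, (∏ p ∈ T, P p)^2 = Ideal.span {((∏ p ∈ T, p : ℕ) : 𝓞 K)} := by
    intro T hT
    rw [← Finset.prod_pow, Finset.prod_congr rfl (fun p hp => hP p (hT hp)),
      Ideal.prod_span_singleton]
    push_cast; rfl
  have hprime : ∀ T ⊆ S, ∀ p ∈ T, p.Prime := fun T hT p hp => ((hram p).mp (hT hp)).1
  have hpf : ∀ T ⊆ S, (∏ p ∈ T, p).primeFactors = T := fun T hT =>
    Nat.primeFactors_prod (hprime T hT)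
  have hsqf : ∀ T ⊆ S, Squarefree (∏ p ∈ T, p) := by
    intro T hT
    apply Finset.squarefree_prod_of_pairwise_isCoprime
    · intro p hp q hq hpq
      exact Nat.coprime_iff_isRelPrime.mp
        ((Nat.coprime_primes (hprime T hT p hp) (hprime T hT q hq)).mpr hpq)
    · intro p hp
      exact (hprime T hT p hp).prime.irreducible.squarefree
  obtain ⟨β, hβ⟩ := gq_alpha_int d K α hα
  have hβ2 : β^2 = -(d : 𝓞 K) := by
    apply RingOfIntegers.ext
    simpa [hβ] using hα
  have hpfd : d.primeFactors ⊆ S := fun p hp =>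
    (hram p).mpr ⟨Nat.prime_of_mem_primeFactors hp, Or.inl (Nat.dvd_of_mem_primeFactors hp)⟩
  -- principal criterion
  have hone : ∀ T ⊆ S, (∏ p ∈ T, gqCls (P p) = 1 ↔
      ∃ y : 𝓞 K, (Ideal.span {y})^2 = Ideal.span {((∏ p ∈ T, p : ℕ) : 𝓞 K)}) := by
    intro T hT
    rw [← (hcls T hT).2, gqCls_eq_one _ (hcls T hT).1, ← hsq T hT]
    exact ⟨fun ⟨y, hy⟩ => ⟨y, by rw [hy]⟩, fun ⟨y, hy⟩ => ⟨y, (gq_sq_inj _ _ hy).symm⟩⟩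
  refine gq_count (fun p => gqCls (P p)) S (if d = 1 then {2} else d.primeFactors) ?_ ?_ ?_ ?_ ?_
  · split_ifs with h1
    · rw [Finset.singleton_subset_iff, hram]
      exact ⟨Nat.prime_two, Or.inr ⟨rfl, by omega⟩⟩
    · exact hpfd
  · split_ifs with h1
    · simp
    · rw [Nat.nonempty_primeFactors]; omega
  · intro p hp
    rw [pow_two, ← gqCls_mul _ _ (hP0 p hp) (hP0 p hp), ← pow_two,
      gqCls_eq_one _ (pow_ne_zero 2 (hP0 p hp))]
    exact ⟨_, hP p hp⟩
  · intro c hc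
    obtain ⟨J, m, hm, hJ, rfl⟩ := gq_surj d hd hsf K α hα hgen c hc
    have hsub : m.primeFactors ⊆ S := fun p hp => (hram p).mpr
      ⟨Nat.prime_of_mem_primeFactors hp, gq_ram_of_sq d hd hsf K α hα hgen J m hm hJ p
        (Nat.prime_of_mem_primeFactors hp) (Nat.dvd_of_mem_primeFactors hp)⟩
    refine ⟨m.primeFactors, hsub, ?_⟩
    rw [← (hcls _ hsub).2]
    congr 1
    apply gq_sq_inj
    rw [hsq _ hsub, hJ, Nat.prod_primeFactors_of_squarefree hm]
  · intro T hT
    rw [hone T hT]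
    constructor
    · rintro ⟨y, hy⟩
      by_cases h1 : d = 1
      · rw [if_pos h1]
        rw [← Finset.subset_singleton_iff]
        intro p hp
        rcases ((hram p).mp (hT hp)).2 with h | h
        · rw [h1, Nat.dvd_one] at h
          exact absurd h (hprime T hT p hp).ne_one
        · simp [h.1]
      · rw [if_neg h1]
        by_cases h3 : d = 3
        · subst h3
          rw [Nat.Prime.primeFactors Nat.prime_three, ← Finset.subset_singleton_iff]
          intro p hp
          rcases ((hram p).mp (hT hp)).2 with h | h
          · simpa using (Nat.prime_dvd_prime_iff_eq (hprime T hT p hp) Nat.prime_three).mp h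
          · omega
        · rcases gq_kernel d hd hsf h1 h3 K α hα hgen _ (hsqf T hT) y hy with h | h
          · left
            rw [← hpf T hT, h]; simp
          · right
            rw [← hpf T hT, h]
    · rintro (rfl | rfl)
      · exact ⟨1, by simp⟩
      · split_ifs with h1
        · subst h1
          refine ⟨1 + β, ?_⟩
          rw [Ideal.span_singleton_pow, Ideal.span_singleton_eq_span_singleton]
          have hu : β * (-β) = 1 := by push_cast at hβ2; linear_combination -hβ2
          refine ⟨⟨-β, β, by rw [mul_comm]; exact hu, hu⟩, ?_⟩
          simp only [Finset.prod_singleton]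
          push_cast at hβ2 ⊢
          linear_combination (-β - 2) * hβ2
        · refine ⟨β, ?_⟩
          rw [Ideal.span_singleton_pow, hβ2, Ideal.span_singleton_neg,
            Nat.prod_primeFactors_of_squarefree hsf]
end

section
/- Let N be a prime number with N ≡ 5 (mod 8) and let K = ℚ(√−N). Then the 2-primary part of the ideal class group Cl(K) is cyclic of order exactly 2; equivalently, the class number h(−N) of K is congruent to 2 modulo 4 (i.e., 2 divides h(−N) but 4 does not). -/
open NumberField

namespace CNFive

theorem group_lemma {G : Type*} [CommGroup G] [Finite G] (p : G) (hp : p ≠ 1) (hp2 : p ^ 2 = 1)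
    (h1 : ∀ c : G, c ^ 2 = 1 → c = 1 ∨ c = p) (h2 : ∀ c : G, c ^ 2 ≠ p) :
    Nat.card G % 4 = 2 := by
  have hord : orderOf p = 2 := orderOf_eq_prime hp2 hp
  have hdvd : 2 ∣ Nat.card G := hord ▸ orderOf_dvd_natCard p
  by_contra hne
  have h4 : 2 ^ 2 ∣ Nat.card G := by omega
  have : Fact (Nat.Prime 2) := ⟨Nat.prime_two⟩
  obtain ⟨H, hH⟩ := Sylow.exists_subgroup_card_pow_prime 2 h4
  have hsub : (H : Set G) ⊆ {1, p} := by
    intro x hx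
    have hx4 : x ^ 4 = 1 := by
      have := pow_card_eq_one' (x := (⟨x, hx⟩ : H))
      rw [hH] at this
      simpa using congrArg Subtype.val this
    have hx2 : x ^ 2 = 1 := by
      rcases h1 (x ^ 2) (by rw [← pow_mul]; exact hx4) with h | h
      · exact h
      · exact absurd h (h2 x)
    exact h1 x hx2
  have hle := Set.ncard_le_ncard hsub (Set.toFinite _)
  have h2' := Set.ncard_insert_le (1 : G) {p}
  rw [Set.ncard_singleton] at h2'
  have : (H : Set G).ncard = 4 := by
    rw [← Nat.card_coe_set_eq]; exact hH
  omega

theorem two_mul_sq_ne (N : ℕ) (hN : N.Prime) (h5 : N % 8 = 5) :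
    ∀ (n : ℕ) (x y : ℤ), 2 * (n : ℤ) ^ 2 = x ^ 2 + N * y ^ 2 → n = 0 := by
  intro n
  induction n using Nat.strong_induction_on with
  | _ n ih =>
  intro x y h
  have : Fact N.Prime := ⟨hN⟩
  by_cases hn : N ∣ n
  · obtain ⟨m, rfl⟩ := hn
    have hNp : Prime (N : ℤ) := Nat.prime_iff_prime_int.1 hN
    have hx : (N : ℤ) ∣ x := by
      apply hNp.dvd_of_dvd_pow (n := 2)
      refine ⟨2 * N * m ^ 2 - y ^ 2, ?_⟩
      push_cast at h
      linear_combination -h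
    obtain ⟨x', rfl⟩ := hx
    have hN0 : (N : ℤ) ≠ 0 := hNp.ne_zero
    have h' : 2 * (N : ℤ) * m ^ 2 = N * x' ^ 2 + y ^ 2 := by
      apply mul_left_cancel₀ hN0
      push_cast at h
      linear_combination h
    have hy : (N : ℤ) ∣ y := by
      apply hNp.dvd_of_dvd_pow (n := 2)
      exact ⟨2 * m ^ 2 - x' ^ 2, by linear_combination -h'⟩
    obtain ⟨y', rfl⟩ := hy
    have hred : 2 * (m : ℤ) ^ 2 = x' ^ 2 + N * y' ^ 2 := by
      apply mul_left_cancel₀ hN0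
      linear_combination h'
    rcases Nat.eq_zero_or_pos m with rfl | hm
    · simp
    · have := ih m (by have := hN.two_le; nlinarith) x' y' hred
      simp [this]
  · exfalso
    have hz : (2 : ZMod N) * (n : ZMod N) ^ 2 = (x : ZMod N) ^ 2 := by
      have := congrArg (Int.cast : ℤ → ZMod N) h
      push_cast at this
      simpa using this
    have hn0 : (n : ZMod N) ≠ 0 := by
      rwa [Ne, ZMod.natCast_eq_zero_iff]
    have hs : IsSquare (2 : ZMod N) := by
      refine ⟨x / n, ?_⟩
      field_simp
      linear_combination hz
    rw [ZMod.exists_sq_eq_two_iff (by omega)] at hs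
    omega

theorem rat_int_of_isIntegral_complex (q : ℚ) (h : IsIntegral ℤ (q : ℂ)) : ∃ m : ℤ, q = m := by
  have h' : IsIntegral ℤ q := by
    have : (q : ℂ) = algebraMap ℚ ℂ q := by simp
    rw [this] at h
    exact (isIntegral_algebraMap_iff (algebraMap ℚ ℂ).injective).1 h
  obtain ⟨m, hm⟩ := IsIntegrallyClosed.isIntegral_iff.1 h'
  exact ⟨m, by simpa using hm.symm⟩

theorem exists_int_of_isIntegral (N : ℕ) (hN : N.Prime) (h5 : N % 8 = 5)
    (K : Type) [Field K] [NumberField K]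
    (α : K) (hα : α ^ 2 = -(N : K)) (hgen : Algebra.adjoin ℚ {α} = ⊤) (x : K)
    (hx : IsIntegral ℤ x) : ∃ a b : ℤ, x = a + b * α := by
  have hrat : ∃ p q : ℚ, x = p + q * α := by
    have hall : ∀ y ∈ Algebra.adjoin ℚ {α}, ∃ p q : ℚ, y = p + q * α := by
      intro y hy
      induction hy using Algebra.adjoin_induction with
      | mem y hy =>
        obtain rfl := hy
        exact ⟨0, 1, by simp⟩
      | algebraMap r => exact ⟨r, 0, by simp⟩
      | add y z _ _ hy hz =>
        obtain ⟨a, b, rfl⟩ := hy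
        obtain ⟨c, d, rfl⟩ := hz
        exact ⟨a + c, b + d, by push_cast; ring⟩
      | mul y z _ _ hy hz =>
        obtain ⟨a, b, rfl⟩ := hy
        obtain ⟨c, d, rfl⟩ := hz
        refine ⟨a * c - N * (b * d), a * d + b * c, ?_⟩
        push_cast
        linear_combination (b : K) * d * hα
    exact hall x (by rw [hgen]; trivial)
  obtain ⟨p, q, rfl⟩ := hrat
  obtain ⟨φ⟩ : Nonempty (K →+* ℂ) := inferInstance
  have hφα : (φ α) ^ 2 = -(N : ℂ) := by rw [← map_pow, hα]; simp
  have hconj : (starRingEnd ℂ) (φ α) = - φ α := by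
    have him : (φ α).re = 0 := by
      have h1 := congrArg Complex.re hφα
      have h2 := congrArg Complex.im hφα
      simp [pow_two] at h1 h2
      have hNpos : (0 : ℝ) < N := by exact_mod_cast hN.pos
      by_contra hre
      have : (φ α).im = 0 := by
        have : (φ α).re * (φ α).im = 0 := by linarith
        exact (mul_eq_zero.1 this).resolve_left hre
      rw [this] at h1
      nlinarith [sq_nonneg (φ α).re]
    apply Complex.ext <;> simp [him]
  have hi1 : IsIntegral ℤ (φ (p + q * α)) := hx.map φ.toIntAlgHom
  have hi2 : IsIntegral ℤ ((starRingEnd ℂ) (φ (p + q * α))) := hi1.map (starRingEnd ℂ).toIntAlgHom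
  obtain ⟨m, hm⟩ := rat_int_of_isIntegral_complex (2 * p) (by
    have e : ((2 * p : ℚ) : ℂ) = φ (p + q * α) + (starRingEnd ℂ) (φ (p + q * α)) := by
      simp only [map_add, map_mul, map_ratCast, hconj]
      push_cast
      ring
    rw [e]
    exact hi1.add hi2)
  obtain ⟨k, hk⟩ := rat_int_of_isIntegral_complex (p ^ 2 + N * q ^ 2) (by
    have e : ((p ^ 2 + N * q ^ 2 : ℚ) : ℂ) =
        φ (p + q * α) * (starRingEnd ℂ) (φ (p + q * α)) := by
      simp only [map_add, map_mul, map_ratCast, hconj]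
      push_cast
      linear_combination (q : ℂ) ^ 2 * hφα
    rw [e]
    exact hi1.mul hi2)
  have hNp : Prime (N : ℤ) := Nat.prime_iff_prime_int.1 hN
  obtain ⟨t, ht⟩ : ∃ t : ℤ, 2 * N * q = t := by
    apply rat_int_of_isIntegral_complex
    apply IsIntegral.of_pow (n := 2) (by norm_num)
    have : (((2 * N * q : ℚ) : ℂ)) ^ 2 = ((N * (4 * k - m ^ 2) : ℤ) : ℂ) := by
      have : (2 * N * q : ℚ) ^ 2 = ((N * (4 * k - m ^ 2) : ℤ) : ℚ) := by
        push_cast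
        rw [← hk, ← hm]; ring
      exact_mod_cast congrArg (Rat.cast : ℚ → ℂ) this
    rw [this]
    exact isIntegral_algebraMap (R := ℤ) (A := ℂ)
  have ht2 : t ^ 2 = N * (4 * k - m ^ 2) := by
    have : (t : ℚ) ^ 2 = N * (4 * k - m ^ 2) := by
      rw [← hk, ← hm, ← ht]; ring
    exact_mod_cast this
  obtain ⟨s, rfl⟩ := hNp.dvd_of_dvd_pow (Dvd.intro _ ht2.symm)
  have hs : (N : ℤ) * s ^ 2 = 4 * k - m ^ 2 := by
    apply mul_left_cancel₀ hNp.ne_zero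
    linear_combination ht2
  have hNq : (N : ℚ) ≠ 0 := by exact_mod_cast hN.ne_zero
  have hq : 2 * q = s := by
    apply mul_left_cancel₀ hNq
    push_cast at ht
    linear_combination ht
  obtain ⟨w, hw⟩ : ∃ w : ℤ, (N : ℤ) = 4 * w + 1 := ⟨N / 4, by omega⟩
  have hsum : m ^ 2 + s ^ 2 = 4 * (k - w * s ^ 2) := by rw [hw] at hs; linear_combination hs
  have heven : Even m ∧ Even s := by
    generalize k - w * s ^ 2 = v at hsum
    rcases Int.even_or_odd' m with ⟨m', rfl | rfl⟩ <;> rcases Int.even_or_odd' s with ⟨s', rfl | rfl⟩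
    · simp
    all_goals exfalso; ring_nf at hsum; omega
  obtain ⟨⟨m', hm'⟩, ⟨s', hs'⟩⟩ := heven
  refine ⟨m', s', ?_⟩
  have e1 : p = m' := by rw [hm'] at hm; push_cast at hm; linarith
  have e2 : q = s' := by rw [hs'] at hq; push_cast at hq; linarith
  rw [e1, e2]; simp


open Zsqrtd

/-- The `ℤ`-linear coordinates on `ℤ√d`. -/
def coordEquiv (d : ℤ) : ℤ√d ≃ₗ[ℤ] (Fin 2 → ℤ) where
  toFun z := ![z.re, z.im]
  invFun f := ⟨f 0, f 1⟩
  map_add' x y := by ext i; fin_cases i <;> simp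
  map_smul' c x := by ext i; fin_cases i <;> simp
  left_inv z := by simp
  right_inv f := by ext i; fin_cases i <;> simp

/-- The standard basis of `ℤ√d`. -/
noncomputable def zbasis (d : ℤ) : Module.Basis (Fin 2) ℤ (ℤ√d) := .ofEquivFun (coordEquiv d)

instance (d : ℤ) : Module.Free ℤ (ℤ√d) := .of_basis (zbasis d)
instance (d : ℤ) : Module.Finite ℤ (ℤ√d) := .of_basis (zbasis d)

theorem algebraNorm_eq {d : ℤ} (z : ℤ√d) : Algebra.norm ℤ z = z.norm := by
  rw [Algebra.norm_eq_matrix_det (zbasis d), Matrix.det_fin_two]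
  simp only [Algebra.leftMulMatrix_eq_repr_mul, zbasis, Module.Basis.ofEquivFun_repr_apply,
    Module.Basis.coe_ofEquivFun, coordEquiv, Zsqrtd.norm_def]
  simp

theorem absNorm_span {d : ℤ} [IsDedekindDomain (ℤ√d)] (hd : d ≤ 0) (z : ℤ√d) :
    ((Ideal.absNorm (Ideal.span {z}) : ℕ) : ℤ) = z.norm := by
  rw [Ideal.absNorm_span_singleton, algebraNorm_eq, Int.natAbs_of_nonneg (Zsqrtd.norm_nonneg hd z)]

/-- The prime above `2`. -/
def P (d : ℤ) : Ideal (ℤ√d) := Ideal.span {(2 : ℤ√d), ⟨1, 1⟩}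

theorem P_mul_P {N : ℕ} (h5 : N % 8 = 5) : P (-N : ℤ) * P (-N : ℤ) = Ideal.span {2} := by
  obtain ⟨w, hw⟩ : ∃ w : ℤ, (N : ℤ) = 4 * w + 1 := ⟨N / 4, by omega⟩
  unfold P
  rw [Ideal.span_pair_mul_span_pair]
  apply _root_.le_antisymm
  · rw [Ideal.span_le]
    rintro x (rfl | rfl | rfl | rfl) <;> simp only [SetLike.mem_coe, Ideal.mem_span_singleton]
    · exact ⟨2, rfl⟩
    · exact ⟨_, rfl⟩
    · exact ⟨_, mul_comm _ _⟩
    · exact ⟨⟨-2 * w, 1⟩, by ext <;> simp <;> linarith⟩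
  · rw [Ideal.span_singleton_le_iff_mem]
    have h1 : (2 * 2 : ℤ√(-N : ℤ)) ∈ Ideal.span {(2 * 2 : ℤ√(-N : ℤ)), 2 * ⟨1, 1⟩, ⟨1, 1⟩ * 2, ⟨1, 1⟩ * ⟨1, 1⟩} :=
      Ideal.subset_span (by simp)
    have h2 : (2 * ⟨1, 1⟩ : ℤ√(-N : ℤ)) ∈ Ideal.span {(2 * 2 : ℤ√(-N : ℤ)), 2 * ⟨1, 1⟩, ⟨1, 1⟩ * 2, ⟨1, 1⟩ * ⟨1, 1⟩} :=
      Ideal.subset_span (by simp)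
    have h3 : (⟨1, 1⟩ * ⟨1, 1⟩ : ℤ√(-N : ℤ)) ∈ Ideal.span {(2 * 2 : ℤ√(-N : ℤ)), 2 * ⟨1, 1⟩, ⟨1, 1⟩ * 2, ⟨1, 1⟩ * ⟨1, 1⟩} :=
      Ideal.subset_span (by simp)
    have := Ideal.sub_mem _ (Ideal.sub_mem _ h2 h3) (Ideal.mul_mem_left _ (w : ℤ√(-N : ℤ)) h1)
    convert this using 1
    ext <;> simp <;> linarith

theorem P_ne_span {N : ℕ} (h5 : N % 8 = 5) [IsDomain (ℤ√(-N : ℤ))] (z : ℤ√(-N : ℤ)) : P (-N : ℤ) ≠ Ideal.span {z} := by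
  intro h
  have h1 := P_mul_P h5
  rw [h, Ideal.span_singleton_mul_span_singleton, Ideal.span_singleton_eq_span_singleton] at h1
  have h2 := Zsqrtd.norm_eq_of_associated (by omega) h1
  rw [Zsqrtd.norm_mul] at h2
  have h3 : (2 : ℤ√(-N : ℤ)).norm = 4 := by simp [Zsqrtd.norm_def]
  have h4 := Zsqrtd.norm_nonneg (by omega) z
  have h5' : z.norm = 2 := by nlinarith
  rw [Zsqrtd.norm_def] at h5'
  have hN5 : (5 : ℤ) ≤ N := by omega
  have him : z.im = 0 := by
    by_contra hne
    have : 1 ≤ z.im * z.im := by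
      have := mul_self_pos.2 hne
      omega
    nlinarith [mul_self_nonneg z.re]
  rw [him] at h5'
  have : z.re * z.re = 2 := by linarith
  have a1 : z.re < 2 := by nlinarith
  have a2 : -2 < z.re := by nlinarith
  interval_cases z.re <;> omega

theorem P_ne_bot (d : ℤ) : P d ≠ ⊥ := by
  intro h
  have : (2 : ℤ√d) ∈ P d := Ideal.subset_span (by simp)
  rw [h, Ideal.mem_bot] at this
  have := congrArg Zsqrtd.re this
  simp at this

theorem not_sq {N : ℕ} (hN : N.Prime) (h5 : N % 8 = 5) [IsDedekindDomain (ℤ√(-N : ℤ))]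
    (I : Ideal (ℤ√(-N : ℤ))) (hI : I ≠ ⊥) (β : ℤ√(-N : ℤ)) :
    I * I * P (-N : ℤ) ≠ Ideal.span {β} := by
  intro h
  have hP : Ideal.absNorm (P (-N : ℤ)) = 2 := by
    have := congrArg Ideal.absNorm (P_mul_P h5)
    have h2 := absNorm_span (d := -N) (by omega) 2
    rw [map_mul] at this
    have h3 : (2 : ℤ√(-N : ℤ)).norm = 4 := by simp [Zsqrtd.norm_def]
    have : Ideal.absNorm (P (-N : ℤ)) * Ideal.absNorm (P (-N : ℤ)) = 4 := by omega
    nlinarith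
  have h1 := congrArg Ideal.absNorm h
  have h2 := absNorm_span (d := -N) (by omega) β
  rw [← h1, map_mul, map_mul, hP, Zsqrtd.norm_def] at h2
  have := two_mul_sq_ne N hN h5 (Ideal.absNorm I) β.re β.im (by push_cast at h2; linarith)
  rw [Ideal.absNorm_eq_zero_iff] at this
  exact hI this

theorem ideal_sq_inj {R : Type*} [CommRing R] [IsDedekindDomain R] {I J : Ideal R}
    (h : I ^ 2 = J ^ 2) : I = J := by
  apply dvd_antisymm
  · rw [← UniqueFactorizationMonoid.pow_dvd_pow_iff_dvd (n := 2) two_ne_zero, h]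
  · rw [← UniqueFactorizationMonoid.pow_dvd_pow_iff_dvd (n := 2) two_ne_zero, h]

/-- An ideal with principal square is equivalent to a conjugation-invariant one. -/
theorem exists_ambiguous {N : ℕ} [IsDedekindDomain (ℤ√(-N : ℤ))]
    (I : Ideal (ℤ√(-N : ℤ))) (hI : I ≠ ⊥) (β : ℤ√(-N : ℤ)) (hβ : I * I = Ideal.span {β}) :
    ∃ δ : ℤ√(-N : ℤ), δ ≠ 0 ∧
      (Ideal.span {δ} * I).map (starRingEnd (ℤ√(-N : ℤ))) = Ideal.span {δ} * I := by
  have hn0 : Ideal.absNorm I ≠ 0 := by rwa [Ne, Ideal.absNorm_eq_zero_iff]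
  set n : ℕ := Ideal.absNorm I with hn
  have hnR : (n : ℤ√(-N : ℤ)) ≠ 0 := by exact_mod_cast hn0
  obtain ⟨β, hβ, hδ⟩ : ∃ β : ℤ√(-N : ℤ), I * I = Ideal.span {β} ∧ (n : ℤ√(-N : ℤ)) + β ≠ 0 := by
    by_cases h : (n : ℤ√(-N : ℤ)) + β = 0
    · refine ⟨-β, by rw [hβ, Ideal.span_singleton_neg], ?_⟩
      intro h'
      apply hnR
      have : (2 : ℤ√(-N : ℤ)) * n = 0 := by linear_combination h + h'
      exact (mul_eq_zero.1 this).resolve_left two_ne_zero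
    · exact ⟨β, hβ, h⟩
  have hnorm : β.norm = n ^ 2 := by
    rw [← absNorm_span (by omega), ← hβ, map_mul]
    push_cast
    rw [← hn]; ring
  have hββ : β * star β = n ^ 2 := by
    rw [← Zsqrtd.norm_eq_mul_conj, hnorm]; push_cast; rfl
  set I' := I.map (starRingEnd (ℤ√(-N : ℤ))) with hI'
  have hβ' : I' * I' = Ideal.span {star β} := by
    rw [hI', ← Ideal.map_mul, hβ, Ideal.map_span, Set.image_singleton]; rfl
  have hII' : I * I' = Ideal.span {(n : ℤ√(-N : ℤ))} := by
    apply ideal_sq_inj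
    rw [Ideal.span_singleton_pow, ← hββ, ← Ideal.span_singleton_mul_span_singleton, ← hβ, ← hβ']
    ring
  refine ⟨star (n + β), star_ne_zero.2 hδ, ?_⟩
  rw [Ideal.map_mul, Ideal.map_span, Set.image_singleton, ← hI', starRingEnd_apply, star_star]
  apply Ideal.span_singleton_mul_right_injective hnR
  simp only
  have e : (n : ℤ√(-N : ℤ)) * star (n + β) = (n + β) * star β := by
    rw [star_add, star_natCast]
    linear_combination -hββ
  rw [← mul_assoc, ← mul_assoc, Ideal.span_singleton_mul_span_singleton (n : ℤ√(-N : ℤ)) (star (n + β)), e,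
    ← Ideal.span_singleton_mul_span_singleton, ← hβ', ← hII']
  ring

theorem span_pair_le {R : Type*} [CommRing R] {a b : R} {I : Ideal R} (ha : a ∈ I) (hb : b ∈ I) :
    Ideal.span {a, b} ≤ I := by
  rw [Ideal.span_le]
  rintro x (rfl | rfl) <;> assumption

/-- Hermite normal form of an ideal of `ℤ√d`. -/
theorem hnf {d : ℤ} (hd : d < 0) (J : Ideal (ℤ√d)) (hJ : J ≠ ⊥) :
    ∃ g a b : ℤ, 0 < g ∧ 0 < a ∧ J = Ideal.span {(g : ℤ√d)} * Ideal.span {(a : ℤ√d), ⟨b, 1⟩} ∧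
      a ∣ b * b - d ∧ ∀ x : ℤ, (x : ℤ√d) ∈ J → g * a ∣ x := by
  obtain ⟨a₀, ha₀⟩ := (IsPrincipalIdealRing.principal (J.comap (Int.castRingHom (ℤ√d)))).principal
  let B : Ideal ℤ :=
    { carrier := {y | ∃ x : ℤ, (⟨x, y⟩ : ℤ√d) ∈ J}
      add_mem' := by
        rintro y y' ⟨x, hx⟩ ⟨x', hx'⟩
        exact ⟨x + x', J.add_mem hx hx'⟩
      zero_mem' := ⟨0, J.zero_mem⟩
      smul_mem' := by
        rintro c y ⟨x, hx⟩
        refine ⟨c * x, ?_⟩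
        have := J.mul_mem_left (c : ℤ√d) hx
        rwa [Zsqrtd.smul_val] at this }
  obtain ⟨g₀, hg₀⟩ := (IsPrincipalIdealRing.principal B).principal
  have hA : ∀ x : ℤ, (x : ℤ√d) ∈ J ↔ |a₀| ∣ x := by
    intro x
    rw [abs_dvd]
    have : x ∈ J.comap (Int.castRingHom (ℤ√d)) ↔ x ∈ Submodule.span ℤ {a₀} := by rw [ha₀]
    rw [← Ideal.mem_span_singleton]
    simpa using this
  have hB : ∀ y : ℤ, (∃ x : ℤ, (⟨x, y⟩ : ℤ√d) ∈ J) ↔ |g₀| ∣ y := by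
    intro y
    rw [abs_dvd]
    have : y ∈ B ↔ y ∈ Submodule.span ℤ {g₀} := by rw [hg₀]
    rw [← Ideal.mem_span_singleton]
    exact this
  obtain ⟨z, hz, hz0⟩ := Submodule.exists_mem_ne_zero_of_ne_bot hJ
  have hnz : z.norm ≠ 0 := by rwa [Ne, Zsqrtd.norm_eq_zero_iff hd]
  have hnzJ : (z.norm : ℤ√d) ∈ J := by
    rw [Zsqrtd.norm_eq_mul_conj]; exact J.mul_mem_right _ hz
  have ha0 : 0 < |a₀| := by
    rcases (abs_nonneg a₀).lt_or_eq with h | h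
    · exact h
    · rw [hA, ← h, zero_dvd_iff] at hnzJ
      exact absurd hnzJ hnz
  generalize |a₀| = a at *
  generalize hgg : |g₀| = g at *
  have haJ : (a : ℤ√d) ∈ J := (hA a).2 dvd_rfl
  have hga : g ∣ a := by
    refine (hB a).1 ⟨0, ?_⟩
    have := J.mul_mem_left sqrtd haJ
    convert this using 1
    ext <;> simp
  have hg0 : 0 < g := by
    rcases (abs_nonneg g₀).lt_or_eq with h | h
    · rwa [hgg] at h
    · rw [hgg] at h
      rw [← h, zero_dvd_iff] at hga
      omega
  obtain ⟨b, hb⟩ := (hB g).2 dvd_rfl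
  have hgb : g ∣ b := by
    refine (hB b).1 ⟨d * g, ?_⟩
    have := J.mul_mem_left sqrtd hb
    rwa [Zsqrtd.muld_val] at this
  obtain ⟨a', rfl⟩ := hga
  obtain ⟨b', rfl⟩ := hgb
  refine ⟨g, a', b', hg0, by nlinarith, ?_, ?_, fun x hx => (hA x).1 hx⟩
  · have e1 : (g : ℤ√d) * a' = ((g * a' : ℤ) : ℤ√d) := by push_cast; rfl
    have e2 : (g : ℤ√d) * ⟨b', 1⟩ = ⟨g * b', g⟩ := by rw [Zsqrtd.smul_val, mul_one]
    have e : Ideal.span {(g : ℤ√d)} * Ideal.span {(a' : ℤ√d), ⟨b', 1⟩} =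
        Ideal.span {((g * a' : ℤ) : ℤ√d), ⟨g * b', g⟩} := by
      rw [Ideal.span_mul_span', Set.singleton_mul, Set.image_pair, e1, e2]
    rw [e]
    apply _root_.le_antisymm
    · rintro ⟨x, y⟩ hxy
      obtain ⟨k, rfl⟩ := (hB y).1 ⟨x, hxy⟩
      have h1 : ((x - k * (g * b') : ℤ) : ℤ√d) ∈ J := by
        convert J.sub_mem hxy (J.mul_mem_left (k : ℤ√d) hb) using 1
        ext <;> simp
        ring
      obtain ⟨l, hl⟩ := (hA _).1 h1
      rw [Ideal.mem_span_pair]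
      refine ⟨l, k, ?_⟩
      ext <;> simp
      · linarith
      · ring
    · exact span_pair_le haJ hb
  · have h1 : ((g * (b' * b' - d) : ℤ) : ℤ√d) ∈ J := by
      convert J.mul_mem_left (⟨b', -1⟩ : ℤ√d) hb using 1
      ext <;> simp <;> ring
    exact (mul_dvd_mul_iff_left hg0.ne').1 ((hA _).1 h1)

theorem ambiguous_class {N : ℕ} (hN : N.Prime) (h5 : N % 8 = 5) [IsDomain (ℤ√(-N : ℤ))]
    (J : Ideal (ℤ√(-N : ℤ))) (hJ : J ≠ ⊥) (hinv : J.map (starRingEnd (ℤ√(-N : ℤ))) = J) :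
    ∃ x y : ℤ√(-N : ℤ), x ≠ 0 ∧ y ≠ 0 ∧ (Ideal.span {x} * J = Ideal.span {y} ∨
      Ideal.span {x} * J = Ideal.span {y} * P (-N : ℤ)) := by
  have hNpos := hN.pos
  obtain ⟨g, a, b, hg, ha, hJe, hdvd, hmem⟩ := hnf (d := -N) (by omega) J hJ
  have hgR : (g : ℤ√(-N : ℤ)) ≠ 0 := by exact_mod_cast hg.ne'
  have hs0 : (sqrtd : ℤ√(-N : ℤ)) ≠ 0 := by
    intro h
    simpa using congrArg Zsqrtd.im h
  have hNR : ((N : ℤ) : ℤ√(-N : ℤ)) ≠ 0 := by exact_mod_cast hN.ne_zero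
  have h2b : a ∣ 2 * b := by
    have hb : (⟨g * b, g⟩ : ℤ√(-N : ℤ)) ∈ J := by
      rw [hJe]
      have : (⟨g * b, g⟩ : ℤ√(-N : ℤ)) = g * ⟨b, 1⟩ := by rw [Zsqrtd.smul_val, mul_one]
      rw [this]
      exact Ideal.mul_mem_mul (Ideal.mem_span_singleton_self _) (Ideal.subset_span (by simp))
    have hb' : (⟨g * b, -g⟩ : ℤ√(-N : ℤ)) ∈ J := by
      have := Ideal.mem_map_of_mem (starRingEnd (ℤ√(-N : ℤ))) hb
      rwa [hinv] at this
    have h := hmem (g * (2 * b)) (by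
      convert J.add_mem hb hb' using 1
      ext <;> simp
      ring)
    exact (mul_dvd_mul_iff_left hg.ne').1 h
  obtain ⟨u, hu⟩ : ∃ u : ℤ, (N : ℤ) = 2 * u + 1 := ⟨N / 2, by omega⟩
  have hNp : Prime (N : ℤ) := Nat.prime_iff_prime_int.1 hN
  -- positive divisors of `N`
  have hdivN : ∀ c : ℤ, 0 < c → c ∣ N → c = 1 ∨ c = N := by
    intro c hc hcN
    lift c to ℕ using hc.le
    have := (Nat.dvd_prime hN).1 (by exact_mod_cast hcN)
    exact_mod_cast this
  -- reduce to the primitive part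
  suffices h : ∃ x y : ℤ√(-N : ℤ), x ≠ 0 ∧ y ≠ 0 ∧
      (Ideal.span {x} * Ideal.span {(a : ℤ√(-N : ℤ)), ⟨b, 1⟩} = Ideal.span {y} ∨
      Ideal.span {x} * Ideal.span {(a : ℤ√(-N : ℤ)), ⟨b, 1⟩} = Ideal.span {y} * P (-N : ℤ)) by
    obtain ⟨x, y, hx, hy, h⟩ := h
    refine ⟨x, g * y, hx, mul_ne_zero hgR hy, ?_⟩
    rw [hJe, mul_left_comm, ← Ideal.span_singleton_mul_span_singleton, mul_assoc]
    exact h.imp (fun h => by rw [h]) (fun h => by rw [h])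
  rcases Int.even_or_odd' a with ⟨c, rfl | rfl⟩
  · have hcb : c ∣ b := (mul_dvd_mul_iff_left two_ne_zero).1 h2b
    have hcN : c ∣ N := by
      have h1 : c ∣ b * b - -N := dvd_trans (Dvd.intro_left 2 rfl) hdvd
      have h2 : c ∣ b * b := hcb.mul_right b
      have := dvd_sub h1 h2
      rwa [show b * b - -(N : ℤ) - b * b = N by ring] at this
    have hbodd : Odd b := by
      have h1 : (2 : ℤ) ∣ b * b - -N := dvd_trans (Dvd.intro _ rfl) hdvd
      rcases Int.even_or_odd b with hb | hb
      · obtain ⟨r, rfl⟩ := hb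
        obtain ⟨v, hv⟩ := h1
        exfalso
        ring_nf at hv
        omega
      · exact hb
    rcases hdivN c (by omega) hcN with rfl | rfl
    · refine ⟨1, 1, one_ne_zero, one_ne_zero, Or.inr ?_⟩
      congr 1
      obtain ⟨r, rfl⟩ := hbodd
      unfold P
      apply _root_.le_antisymm
      · apply span_pair_le
        · exact Ideal.subset_span (by simp)
        · rw [Ideal.mem_span_pair]
          exact ⟨r, 1, by ext <;> simp; ring⟩
      · apply span_pair_le
        · exact Ideal.subset_span (by simp)
        · rw [Ideal.mem_span_pair]
          exact ⟨-r, 1, by ext <;> simp; ring⟩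
    · obtain ⟨k, rfl⟩ := hcb
      have hk : Odd k := (Int.odd_mul.1 hbodd).2
      obtain ⟨r, rfl⟩ := hk
      refine ⟨sqrtd, (N : ℤ), hs0, hNR, Or.inr ?_⟩
      unfold P
      rw [Ideal.span_mul_span', Ideal.span_mul_span', Set.singleton_mul, Set.singleton_mul,
        Set.image_pair, Set.image_pair]
      obtain ⟨w, hw⟩ : ∃ w : ℤ, (N : ℤ) = 4 * w + 1 := ⟨N / 4, by omega⟩
      -- generators `2N√`, `N (k √ - 1)` versus `2N`, `N (1 + √)` with `k = 2r+1`
      apply _root_.le_antisymm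
      · apply span_pair_le
        · rw [Ideal.mem_span_pair]
          exact ⟨sqrtd, 0, by ext <;> simp; ring⟩
        · rw [Ideal.mem_span_pair]
          refine ⟨⟨-(r + 1), 0⟩, ⟨2 * r + 1, 0⟩, ?_⟩
          ext <;> simp <;> ring
      · have h2 : ((N : ℤ) : ℤ√(-N : ℤ)) * 2 ∈ Ideal.span {sqrtd * ((2 * N : ℤ) : ℤ√(-N : ℤ)),
            sqrtd * ⟨N * (2 * r + 1), 1⟩} := by
          rw [Ideal.mem_span_pair]
          refine ⟨⟨0, (2 * r + 1) * (2 * r + 1)⟩, ⟨-2, -2 * (2 * r + 1)⟩, ?_⟩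
          ext <;> simp <;> ring
        apply span_pair_le h2
        have hs : sqrtd * ((2 * N : ℤ) : ℤ√(-N : ℤ)) ∈ Ideal.span {sqrtd * ((2 * N : ℤ) : ℤ√(-N : ℤ)),
            sqrtd * ⟨N * (2 * r + 1), 1⟩} := Ideal.subset_span (by simp)
        have ht : sqrtd * ⟨N * (2 * r + 1), 1⟩ ∈ Ideal.span {sqrtd * ((2 * N : ℤ) : ℤ√(-N : ℤ)),
            sqrtd * ⟨N * (2 * r + 1), 1⟩} := Ideal.subset_span (by simp)
        have := Ideal.add_mem _ (Ideal.sub_mem _ ht (Ideal.mul_mem_left _ (r : ℤ√(-N : ℤ)) hs)) h2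
        convert this using 1
        ext <;> simp <;> ring
  · have hab : 2 * c + 1 ∣ b := by
      refine IsCoprime.dvd_of_dvd_mul_left ?_ h2b
      exact ⟨1, -c, by ring⟩
    have haN : 2 * c + 1 ∣ N := by
      have := dvd_sub hdvd (hab.mul_right b)
      rwa [show b * b - -(N : ℤ) - b * b = N by ring] at this
    refine ⟨1, ?_⟩
    rcases hdivN _ ha haN with h | h
    · refine ⟨1, one_ne_zero, one_ne_zero, Or.inl ?_⟩
      rw [h, Ideal.span_singleton_one, Ideal.top_mul, Ideal.eq_top_iff_one]
      exact Ideal.subset_span (by simp)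
    · refine ⟨sqrtd, one_ne_zero, hs0, Or.inl ?_⟩
      rw [h] at hab ⊢
      obtain ⟨k, rfl⟩ := hab
      rw [Ideal.span_singleton_one, Ideal.top_mul]
      apply _root_.le_antisymm
      · apply span_pair_le
        · rw [Ideal.mem_span_singleton]
          exact ⟨⟨0, -1⟩, by ext <;> simp⟩
        · rw [Ideal.mem_span_singleton]
          exact ⟨⟨1, -k⟩, by ext <;> simp⟩
      · rw [Ideal.span_singleton_le_iff_mem, Ideal.mem_span_pair]
        exact ⟨⟨-k, 0⟩, 1, by ext <;> simp [mul_comm]⟩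


theorem classGroup_zsqrtd {N : ℕ} (hN : N.Prime) (h5 : N % 8 = 5) [IsDedekindDomain (ℤ√(-N : ℤ))]
    [Finite (ClassGroup (ℤ√(-N : ℤ)))] : Nat.card (ClassGroup (ℤ√(-N : ℤ))) % 4 = 2 := by
  let P₀ : nonZeroDivisors (Ideal (ℤ√(-N : ℤ))) :=
    ⟨P (-N : ℤ), mem_nonZeroDivisors_of_ne_zero (P_ne_bot _)⟩
  have hP2 : ClassGroup.mk0 P₀ ^ 2 = 1 := by
    rw [← map_pow, ClassGroup.mk0_eq_one_iff]
    refine ⟨⟨2, ?_⟩⟩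
    change P (-N : ℤ) ^ 2 = _
    rw [pow_two, P_mul_P h5]
  refine group_lemma (ClassGroup.mk0 P₀) ?_ hP2 ?_ ?_
  · intro h
    rw [ClassGroup.mk0_eq_one_iff] at h
    obtain ⟨z, hz⟩ := h.principal
    exact P_ne_span h5 z hz
  · intro c hc
    obtain ⟨I, rfl⟩ := ClassGroup.mk0_surjective c
    have hI : (I : Ideal (ℤ√(-N : ℤ))) ≠ ⊥ := nonZeroDivisors.coe_ne_zero I
    rw [← map_pow, ClassGroup.mk0_eq_one_iff] at hc
    obtain ⟨β, hβ⟩ := hc.principal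
    obtain ⟨δ, hδ, hinv⟩ := exists_ambiguous (I : Ideal (ℤ√(-N : ℤ))) hI β (by
      rw [← pow_two]; exact hβ)
    obtain ⟨x, y, hx, hy, h⟩ := ambiguous_class hN h5 _
      (mul_ne_zero (by simpa using hδ) hI) hinv
    rw [← mul_assoc, Ideal.span_singleton_mul_span_singleton] at h
    rcases h with h | h
    · left
      rw [← map_one ClassGroup.mk0, ClassGroup.mk0_eq_mk0_iff]
      exact ⟨x * δ, y, mul_ne_zero hx hδ, hy, by simpa using h⟩
    · right
      rw [ClassGroup.mk0_eq_mk0_iff]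
      exact ⟨x * δ, y, mul_ne_zero hx hδ, hy, h⟩
  · intro c hc
    obtain ⟨I, rfl⟩ := ClassGroup.mk0_surjective c
    have hI : (I : Ideal (ℤ√(-N : ℤ))) ≠ ⊥ := nonZeroDivisors.coe_ne_zero I
    have h1 : ClassGroup.mk0 (I * I * P₀) = 1 := by
      rw [map_mul, map_mul, ← pow_two, hc, ← pow_two, hP2]
    rw [ClassGroup.mk0_eq_one_iff] at h1
    obtain ⟨β, hβ⟩ := h1.principal
    exact not_sq hN h5 (I : Ideal (ℤ√(-N : ℤ))) hI β hβ

end CNFive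


/-- If `N ≡ 5 (mod 8)` is prime and `K = ℚ(√−N)`, then the 2-primary part of `Cl(K)` is cyclic
of order exactly 2; equivalently, the class number `h(−N)` is congruent to 2 modulo 4. -/
theorem classNumber_mod_four_of_five_mod_eight
    (N : ℕ) (hN : N.Prime) (h5 : N % 8 = 5)
    (K : Type) [Field K] [NumberField K]
    (α : K) (hα : α ^ 2 = -(N : K)) (hgen : Algebra.adjoin ℚ {α} = ⊤) :
    Nat.card (ClassGroup (𝓞 K)) % 4 = 2 := by
  have hNpos := hN.pos
  let f : ℤ√(-N : ℤ) →+* K := Zsqrtd.lift ⟨α, by rw [← pow_two, hα]; simp⟩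
  have hf : Function.Injective f := by
    apply Zsqrtd.lift_injective
    intro n hn
    nlinarith [mul_self_nonneg n]
  let _ : Algebra (ℤ√(-N : ℤ)) K := f.toAlgebra
  have hint : IsIntegralClosure (ℤ√(-N : ℤ)) ℤ K :=
    { algebraMap_injective := hf
      isIntegral_iff := by
        intro x
        constructor
        · intro hx
          obtain ⟨a, b, rfl⟩ := CNFive.exists_int_of_isIntegral N hN h5 K α hα hgen x hx
          exact ⟨⟨a, b⟩, rfl⟩
        · rintro ⟨z, rfl⟩
          exact (Algebra.IsIntegral.isIntegral (R := ℤ) z).map f.toIntAlgHom }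
  have hdom : IsDomain (ℤ√(-N : ℤ)) := hf.isDomain f
  have hded : IsDedekindDomain (ℤ√(-N : ℤ)) := IsIntegralClosure.isDedekindDomain ℤ ℚ K _
  let e := ClassGroup.mulEquiv (NumberField.RingOfIntegers.equiv (K := K) (ℤ√(-N : ℤ)))
  have : Finite (ClassGroup (ℤ√(-N : ℤ))) := Finite.of_equiv _ e.toEquiv
  rw [Nat.card_congr e.toEquiv]
  exact CNFive.classGroup_zsqrtd hN h5
end

section
/- Let N be a prime number with N ≡ 1 (mod 8) and let K = ℚ(√−N). Then the 2-primary part of the ideal class group Cl(K) is cyclic of order at least 4; equivalently, Cl(K) has exactly two elements x with x² = 1 (so its Sylow 2-subgroup is cyclic) and 4 divides the class number h(−N). -/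
open NumberField

theorem aux_thue (N : ℕ) (hN : N.Prime) (h1 : N % 8 = 1) :
    ∃ x z : ℤ, 2 * z ^ 2 = x ^ 2 + N := by
  have : Fact N.Prime := ⟨hN⟩
  have hN2 : N ≠ 2 := by rintro rfl; omega
  obtain ⟨s, hs⟩ := (ZMod.exists_sq_eq_two_iff hN2).mpr (Or.inl h1)
  set k := Nat.sqrt N with hk
  have hk1 : N < (k + 1) * (k + 1) := Nat.lt_succ_sqrt N
  have hk2 : k * k ≤ N := Nat.sqrt_le N
  have hk3 : k * k < N := by
    rcases hk2.lt_or_eq with h | h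
    · exact h
    · exfalso
      rw [← h] at hN
      have hk' : k ∣ k * k := ⟨k, rfl⟩
      rcases (Nat.dvd_prime hN).mp hk' with h' | h'
      · rw [h'] at hN; exact Nat.not_prime_one hN
      · have : k * k = k * 1 := by rw [mul_one]; exact h'.symm
        have h0 : 0 < k := by
          rcases Nat.eq_zero_or_pos k with h0 | h0
          · rw [h0] at hN; exact absurd hN Nat.not_prime_zero
          · exact h0
        have := Nat.eq_of_mul_eq_mul_left h0 this
        rw [this] at hN; exact Nat.not_prime_one hN
  let S : Finset (ℕ × ℕ) := Finset.range (k + 1) ×ˢ Finset.range (k + 1)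
  obtain ⟨p, hp, q, hq, hpq, he⟩ := Finset.exists_ne_map_eq_of_card_lt_of_maps_to
    (s := S) (t := (Finset.univ : Finset (ZMod N)))
    (f := fun p => (p.1 : ZMod N) - s * (p.2 : ZMod N))
    (by simp [S, ZMod.card]; exact hk1) (by intro _ _; simp)
  simp only [S, Finset.mem_product, Finset.mem_range] at hp hq
  set x : ℤ := (p.1 : ℤ) - q.1 with hx
  set y : ℤ := (p.2 : ℤ) - q.2 with hy
  have hxb : x ^ 2 < N := by
    have : x ^ 2 ≤ (k : ℤ) ^ 2 := by
      apply sq_le_sq' <;> omega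
    have : (k : ℤ) * k < N := by exact_mod_cast hk3
    nlinarith
  have hyb : y ^ 2 < N := by
    have : y ^ 2 ≤ (k : ℤ) ^ 2 := by
      apply sq_le_sq' <;> omega
    have : (k : ℤ) * k < N := by exact_mod_cast hk3
    nlinarith
  have hd : (N : ℤ) ∣ 2 * y ^ 2 - x ^ 2 := by
    rw [← ZMod.intCast_zmod_eq_zero_iff_dvd]
    push_cast [hx, hy]
    have h3 : (p.1 : ZMod N) - q.1 = s * (p.2 - q.2) := by linear_combination he
    rw [h3, hs]; ring
  obtain ⟨c, hc⟩ := hd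
  have hN0 : (0 : ℤ) < N := by exact_mod_cast hN.pos
  have hc2 : c < 2 := by nlinarith [sq_nonneg x]
  have hc1 : -1 < c := by nlinarith [sq_nonneg y]
  have : c = 0 ∨ c = 1 := by omega
  rcases this with rfl | rfl
  · exfalso
    have h0 : x * x = 2 * (y * y) := by linarith
    have hirr := irrational_sqrt_two
    have hy0 : y = 0 := by
      by_contra hy0
      have : IsSquare (2 : ℚ) := ⟨(x : ℚ) / y, by
        have : (y : ℚ) ≠ 0 := by exact_mod_cast hy0
        field_simp
        have : (x : ℚ) * x = 2 * (y * y) := by exact_mod_cast h0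
        linarith⟩
      rw [Rat.isSquare_iff] at this
      have h2 := this.1
      norm_num at h2
    have hx0 : x = 0 := by
      rw [hy0] at h0; simpa using h0
    apply hpq
    ext <;> omega
  · exact ⟨x, y, by linarith⟩

theorem aux_rat (m : ℚ) (h : IsIntegral ℤ m) : ∃ k : ℤ, m = k := by
  obtain ⟨k, hk⟩ := IsIntegrallyClosed.isIntegral_iff.mp h
  exact ⟨k, by simpa using hk.symm⟩

theorem aux_repQ (N : ℕ)     (K : Type) [Field K] [NumberField K]
    (α : K) (hα : α ^ 2 = -(N : K)) (hgen : Algebra.adjoin ℚ {α} = ⊤) (x : K) :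
    ∃ p q : ℚ, x = p + q * α := by
  have hx : x ∈ Algebra.adjoin ℚ {α} := by rw [hgen]; trivial
  induction hx using Algebra.adjoin_induction with
  | mem x hx => exact ⟨0, 1, by simp at hx; simp [hx]⟩
  | algebraMap r => exact ⟨r, 0, by simp⟩
  | add x y _ _ hx hy =>
    obtain ⟨p, q, rfl⟩ := hx
    obtain ⟨p', q', rfl⟩ := hy
    exact ⟨p + p', q + q', by push_cast; ring⟩
  | mul x y _ _ hx hy =>
    obtain ⟨p, q, rfl⟩ := hx
    obtain ⟨p', q', rfl⟩ := hy
    exact ⟨p * p' - N * q * q', p * q' + q * p', by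
      push_cast; linear_combination (q * q' : K) * hα⟩

theorem aux_conj (N : ℕ) (hN : N.Prime) (z : ℂ) (hz : z ^ 2 = -(N : ℂ)) :
    (starRingEnd ℂ) z = -z := by
  have hN0 : (0 : ℝ) < N := by exact_mod_cast hN.pos
  have h1 := congrArg Complex.re hz
  have h2 := congrArg Complex.im hz
  simp [pow_two] at h1 h2
  have : z.re = 0 := by
    have h3 : z.re * z.im = 0 := by linarith
    rcases mul_eq_zero.mp h3 with h | h
    · exact h
    · rw [h] at h1; nlinarith [mul_self_nonneg z.re]
  apply Complex.ext <;> simp [this]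

theorem aux_int (N : ℕ) (hN : N.Prime) (h1 : N % 8 = 1)
    (K : Type) [Field K] [NumberField K]
    (α : K) (hα : α ^ 2 = -(N : K)) (hgen : Algebra.adjoin ℚ {α} = ⊤) (x : K)
    (hx : IsIntegral ℤ x) : ∃ a b : ℤ, x = a + b * α := by
  obtain ⟨p, q, rfl⟩ := aux_repQ N K α hα hgen x
  let φ : K →+* ℂ := Classical.arbitrary _
  set z := φ α with hz
  have hz2 : z ^ 2 = -(N : ℂ) := by rw [hz, ← map_pow, hα]; simp
  have hzc := aux_conj N hN z hz2
  have i1 : IsIntegral ℤ ((p : ℂ) + q * z) := by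
    have := hx.map φ.toIntAlgHom
    simpa using this
  have i2 : IsIntegral ℤ ((p : ℂ) - q * z) := by
    have := i1.map (starRingEnd ℂ).toIntAlgHom
    simpa [hzc, sub_eq_add_neg] using this
  have down : ∀ r : ℚ, IsIntegral ℤ (r : ℂ) → ∃ k : ℤ, r = k := fun r hr => by
    apply aux_rat
    have : IsIntegral ℤ (algebraMap ℚ ℂ r) := by simpa using hr
    exact (isIntegral_algebraMap_iff (algebraMap ℚ ℂ).injective).mp this
  obtain ⟨m, hm⟩ := down (2 * p) (by
    have h : ((2 * p : ℚ) : ℂ) = (p + q * z) + (p - q * z) := by push_cast; ring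
    rw [h]; exact i1.add i2)
  obtain ⟨n, hn⟩ := down (p ^ 2 + N * q ^ 2) (by
    have h : ((p ^ 2 + N * q ^ 2 : ℚ) : ℂ) = (p + q * z) * (p - q * z) := by
      push_cast; linear_combination ((q : ℂ) ^ 2) * hz2
    rw [h]; exact i1.mul i2)
  have hN0 : (N : ℚ) ≠ 0 := by exact_mod_cast hN.ne_zero
  have hNt : (N * (2 * q)) ^ 2 = N * (4 * n - m ^ 2) := by
    rw [← hm, ← hn]; ring
  obtain ⟨s, hs⟩ := aux_rat (N * (2 * q)) (by
    apply IsIntegral.of_pow (n := 2) (by norm_num)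
    rw [hNt]
    have : (N * (4 * n - m ^ 2) : ℚ) = algebraMap ℤ ℚ (N * (4 * n - m ^ 2)) := by simp
    rw [this]
    exact isIntegral_algebraMap)
  rw [hs] at hNt
  have hs2 : s ^ 2 = N * (4 * n - m ^ 2) := by exact_mod_cast hNt
  have hNs : (N : ℤ) ∣ s := (Nat.prime_iff_prime_int.mp hN).dvd_of_dvd_pow ⟨_, hs2⟩
  obtain ⟨k, rfl⟩ := hNs
  have hk : 2 * q = k := by
    apply mul_left_cancel₀ hN0; rw [hs]; push_cast; ring
  have hkm : N * k ^ 2 + m ^ 2 = 4 * n := by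
    have : (N : ℚ) * k ^ 2 + m ^ 2 = 4 * n := by rw [← hk, ← hm, ← hn]; ring
    exact_mod_cast this
  have hN4 : (N : ℤ) % 4 = 1 := by omega
  have par : m % 2 = 0 ∧ k % 2 = 0 := by
    have hmod : (k ^ 2 + m ^ 2) % 4 = 0 := by
      have : (N * k ^ 2 + m ^ 2) % 4 = 0 := by rw [hkm]; simp
      rwa [Int.add_emod, Int.mul_emod, hN4, one_mul, Int.emod_emod_of_dvd _ (dvd_refl _),
        ← Int.add_emod] at this
    rcases Int.even_or_odd' m with ⟨a, rfl | rfl⟩ <;> rcases Int.even_or_odd' k with ⟨b, rfl | rfl⟩ <;>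
      ring_nf at hmod <;> omega
  obtain ⟨a, rfl⟩ := Int.dvd_of_emod_eq_zero par.1
  obtain ⟨b, rfl⟩ := Int.dvd_of_emod_eq_zero par.2
  refine ⟨a, b, ?_⟩
  have hp : p = a := by push_cast at hm; linarith
  have hq : q = b := by push_cast at hk; linarith
  rw [hp, hq]; simp

theorem aux_equiv (N : ℕ) (hN : N.Prime) (h1 : N % 8 = 1)
    (K : Type) [Field K] [NumberField K]
    (α : K) (hα : α ^ 2 = -(N : K)) (hgen : Algebra.adjoin ℚ {α} = ⊤) :
    Nonempty (ℤ√(-(N : ℤ)) ≃+* 𝓞 K) := by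
  have hαi : IsIntegral ℤ α := by
    apply IsIntegral.of_pow (n := 2) (by norm_num)
    rw [hα]
    have : (-(N : K)) = algebraMap ℤ K (-N) := by simp
    rw [this]; exact isIntegral_algebraMap
  let w : 𝓞 K := ⟨α, hαi⟩
  have hwα : algebraMap (𝓞 K) K w = α := rfl
  have hw : w * w = ((-(N : ℤ) : ℤ) : 𝓞 K) := by
    apply FaithfulSMul.algebraMap_injective (𝓞 K) K
    rw [map_mul, hwα, ← pow_two, hα]; simp
  refine ⟨RingEquiv.ofBijective (Zsqrtd.lift ⟨w, hw⟩) ⟨Zsqrtd.lift_injective _ ?_, ?_⟩⟩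
  · intro n hn
    have : (0 : ℤ) < N := by exact_mod_cast hN.pos
    nlinarith [mul_self_nonneg n]
  · intro x
    obtain ⟨a, b, hab⟩ := aux_int N hN h1 K α hα hgen x x.2
    refine ⟨⟨a, b⟩, ?_⟩
    apply FaithfulSMul.algebraMap_injective (𝓞 K) K
    rw [Zsqrtd.lift_apply_apply, map_add, map_mul, hwα]
    simp [hab]
section aux
open Ideal

/-- Coordinates on `ℤ√d`. -/
def auxLin (d : ℤ) : (ℤ√d) ≃ₗ[ℤ] (ℤ × ℤ) where
  toFun x := (x.re, x.im)
  invFun p := ⟨p.1, p.2⟩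
  map_add' _ _ := rfl
  map_smul' c x := by ext <;> simp
  left_inv _ := rfl
  right_inv _ := rfl

instance auxFree (d : ℤ) : Module.Free ℤ (ℤ√d) := Module.Free.of_equiv (auxLin d).symm
instance auxFinite (d : ℤ) : Module.Finite ℤ (ℤ√d) := Module.Finite.equiv (auxLin d).symm

theorem aux_finrank (d : ℤ) : Module.finrank ℤ (ℤ√d) = 2 := by
  rw [(auxLin d).finrank_eq]; simp

/-- Conjugation on ideals. -/
noncomputable def conjI {d : ℤ} (I : Ideal (ℤ√d)) : Ideal (ℤ√d) :=
  Ideal.map (starRingAut : (ℤ√d) ≃+* (ℤ√d)) I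

theorem mem_conjI {d : ℤ} (I : Ideal (ℤ√d)) (x : ℤ√d) : x ∈ conjI I ↔ star x ∈ I := by
  unfold conjI
  rw [Ideal.mem_map_of_equiv]
  constructor
  · rintro ⟨y, hy, rfl⟩
    simpa using hy
  · intro h
    exact ⟨star x, h, by simp⟩

theorem conjI_mul {d : ℤ} (I J : Ideal (ℤ√d)) : conjI (I * J) = conjI I * conjI J :=
  Ideal.map_mul _ _ _

theorem conjI_span {d : ℤ} (x : ℤ√d) : conjI (span {x}) = span {star x} := by
  unfold conjI
  rw [Ideal.map_span]; simp

theorem absNorm_conjI {d : ℤ} [IsDedekindDomain (ℤ√d)] (I : Ideal (ℤ√d)) :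
    absNorm (conjI I) = absNorm I := by
  rw [absNorm_apply, absNorm_apply, Submodule.cardQuot_apply, Submodule.cardQuot_apply]
  exact (Nat.card_congr (Ideal.quotientEquiv I (conjI I) starRingAut rfl).toEquiv).symm

theorem absNorm_span' {d : ℤ} [IsDedekindDomain (ℤ√d)] (x : ℤ√d) :
    absNorm (span {x}) = x.norm.natAbs := by
  have h : absNorm (span {x}) ^ 2 = x.norm.natAbs ^ 2 := by
    rw [pow_two]
    nth_rewrite 2 [← absNorm_conjI]
    rw [conjI_span, ← map_mul, span_singleton_mul_span_singleton, ← Zsqrtd.norm_eq_mul_conj,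
      absNorm_span_singleton]
    have := Algebra.norm_algebraMap (R := ℤ) (S := ℤ√d) x.norm
    rw [aux_finrank] at this
    simp only [algebraMap_int_eq, eq_intCast] at this
    rw [this, Int.natAbs_pow]
  exact Nat.pow_left_injective (n := 2) (by norm_num) h

variable {N : ℕ}

/-- The prime above two. -/
noncomputable def pTwo (N : ℕ) : Ideal (ℤ√(-(N : ℤ))) := span {2, 1 + Zsqrtd.sqrtd}

theorem pTwo_eq (x : ℤ) (hx : x % 2 = 1) : pTwo N = span {2, (x : ℤ√(-(N : ℤ))) + Zsqrtd.sqrtd} := by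
  obtain ⟨k, rfl⟩ : ∃ k, x = 2 * k + 1 := ⟨x / 2, by omega⟩
  unfold pTwo
  apply le_antisymm <;> rw [span_le] <;> rintro y (rfl | rfl) <;>
    rw [SetLike.mem_coe, mem_span_pair]
  · exact ⟨1, 0, by ring⟩
  · exact ⟨-k, 1, by push_cast; ring⟩
  · exact ⟨1, 0, by ring⟩
  · exact ⟨k, 1, by push_cast; ring⟩

theorem sqrtd_sq : (Zsqrtd.sqrtd * Zsqrtd.sqrtd : ℤ√(-(N : ℤ))) = -(N : ℤ√(-(N : ℤ))) := by
  have := Zsqrtd.dmuld (d := -(N : ℤ))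
  push_cast at this; exact this

theorem pTwo_sq (h1 : N % 8 = 1) : pTwo N * pTwo N = span {2} := by
  obtain ⟨k, rfl⟩ : ∃ k, N = 8 * k + 1 := ⟨N / 8, by omega⟩
  have hw := sqrtd_sq (N := 8 * k + 1)
  push_cast at hw
  unfold pTwo
  rw [span_pair_mul_span_pair]
  set w : ℤ√(-((8 * k + 1 : ℕ) : ℤ)) := Zsqrtd.sqrtd
  apply le_antisymm
  · rw [span_le]
    rintro y (rfl | rfl | rfl | rfl) <;> rw [SetLike.mem_coe, mem_span_singleton]
    · exact ⟨2, by ring⟩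
    · exact ⟨1 + w, by ring⟩
    · exact ⟨1 + w, by ring⟩
    · exact ⟨w - 4 * k, by linear_combination hw⟩
  · rw [span_singleton_le_iff_mem]
    have m1 : (2 * 2 : ℤ√(-((8 * k + 1 : ℕ) : ℤ))) ∈
      span {(2 * 2 : ℤ√(-((8 * k + 1 : ℕ) : ℤ))), 2 * (1 + w), (1 + w) * 2, (1 + w) * (1 + w)} :=
      subset_span (by simp)
    have m2 : (2 * (1 + w) : ℤ√(-((8 * k + 1 : ℕ) : ℤ))) ∈
      span {(2 * 2 : ℤ√(-((8 * k + 1 : ℕ) : ℤ))), 2 * (1 + w), (1 + w) * 2, (1 + w) * (1 + w)} :=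
      subset_span (by simp)
    have m3 : ((1 + w) * (1 + w) : ℤ√(-((8 * k + 1 : ℕ) : ℤ))) ∈
      span {(2 * 2 : ℤ√(-((8 * k + 1 : ℕ) : ℤ))), 2 * (1 + w), (1 + w) * 2, (1 + w) * (1 + w)} :=
      subset_span (by simp)
    have := Ideal.sub_mem _ (Ideal.sub_mem _ m2 m3) (Ideal.mul_mem_left _ (2 * (k : ℤ√(-((8 * k + 1 : ℕ) : ℤ)))) m1)
    have e : (2 : ℤ√(-((8 * k + 1 : ℕ) : ℤ))) =
        2 * (1 + w) - (1 + w) * (1 + w) - 2 * k * (2 * 2) := by linear_combination hw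
    rwa [← e] at this

theorem pTwo_not_principal (hN : N.Prime) (h1 : N % 8 = 1) (g : ℤ√(-(N : ℤ))) :
    pTwo N ≠ span {g} := by
  intro h
  have hsq := pTwo_sq h1
  rw [h, span_singleton_mul_span_singleton] at hsq
  have hd : g * g ∣ 2 := by rw [← mem_span_singleton, hsq]; exact mem_span_singleton_self _
  have hd2 : (2 : ℤ√(-(N : ℤ))) ∣ g * g := by
    rw [← mem_span_singleton, ← hsq]; exact mem_span_singleton_self _
  have hn : g.norm * g.norm ∣ 4 := by
    obtain ⟨c, hc⟩ := hd
    have := congrArg Zsqrtd.norm hc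
    rw [Zsqrtd.norm_mul, Zsqrtd.norm_mul] at this
    refine ⟨c.norm, ?_⟩
    rw [← this]; simp [Zsqrtd.norm_def]
  have hn2 : 4 ∣ g.norm * g.norm := by
    obtain ⟨c, hc⟩ := hd2
    have := congrArg Zsqrtd.norm hc
    rw [Zsqrtd.norm_mul, Zsqrtd.norm_mul] at this
    refine ⟨c.norm, ?_⟩
    rw [this]; simp [Zsqrtd.norm_def]
  have hN17 : (3 : ℤ) ≤ N := by
    have := hN.two_le
    omega
  have hpos : 0 ≤ g.norm := by rw [Zsqrtd.norm_def]; nlinarith [mul_self_nonneg g.re, mul_self_nonneg g.im]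
  have h4 : g.norm * g.norm = 4 := by
    have a := Int.le_of_dvd (by norm_num) hn
    have : 0 < g.norm * g.norm := by
      rcases hpos.lt_or_eq with h | h
      · positivity
      · rw [← h] at hn; norm_num at hn
    have b := Int.le_of_dvd this hn2
    omega
  have h2 : g.norm = 2 := by nlinarith
  rw [Zsqrtd.norm_def] at h2
  have him : g.im = 0 := by
    by_contra him
    have : 0 < g.im * g.im := mul_self_pos.mpr him
    nlinarith [mul_self_nonneg g.re]
  rw [him] at h2
  have : g.re < 2 := by nlinarith
  have : -2 < g.re := by nlinarith
  have : g.re = -1 ∨ g.re = 0 ∨ g.re = 1 := by omega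
  rcases this with h | h | h <;> rw [h] at h2 <;> norm_num at h2

theorem aux_square (hN : N.Prime) (h1 : N % 8 = 1) (x z : ℤ) (hxz : 2 * z ^ 2 = x ^ 2 + N) :
    ∃ I : Ideal (ℤ√(-(N : ℤ))), I * I * pTwo N = span {(x : ℤ√(-(N : ℤ))) + Zsqrtd.sqrtd} := by
  have hx : x % 2 = 1 := by
    have h8 : (N : ℤ) % 8 = 1 := by omega
    rcases Int.emod_two_eq_zero_or_one x with h | h
    · obtain ⟨k, rfl⟩ := Int.dvd_of_emod_eq_zero h
      ring_nf at hxz; omega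
    · exact h
  have hz : z % 2 = 1 := by
    have h8 : (N : ℤ) % 8 = 1 := by omega
    rcases Int.emod_two_eq_zero_or_one z with h | h
    · obtain ⟨k, rfl⟩ := Int.dvd_of_emod_eq_zero h
      obtain ⟨j, rfl⟩ : ∃ j, x = 2 * j + 1 := ⟨x / 2, by omega⟩
      ring_nf at hxz; omega
    · exact h
  have hco : IsCoprime z (2 * x) := by
    rw [Int.isCoprime_iff_gcd_eq_one]
    by_contra hg
    obtain ⟨p, hp, hpd⟩ := Nat.exists_prime_and_dvd hg
    have pz : (p : ℤ) ∣ z := (Int.natCast_dvd_natCast.mpr hpd).trans (Int.gcd_dvd_left _ _)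
    have px : (p : ℤ) ∣ 2 * x := (Int.natCast_dvd_natCast.mpr hpd).trans (Int.gcd_dvd_right _ _)
    have hp' := Nat.prime_iff_prime_int.mp hp
    have px' : (p : ℤ) ∣ x := by
      rcases hp'.dvd_or_dvd px with h | h
      · exfalso
        have : p ∣ 2 := by exact_mod_cast h
        rw [Nat.prime_dvd_prime_iff_eq hp Nat.prime_two] at this
        subst this
        push_cast at pz
        omega
      · exact h
    obtain ⟨a, rfl⟩ := pz
    obtain ⟨b, rfl⟩ := px'
    have : (p : ℤ) * p ∣ N := ⟨2 * a ^ 2 - b ^ 2, by linear_combination -hxz⟩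
    have : p * p ∣ N := by exact_mod_cast this
    have hpN : p = N := (Nat.prime_dvd_prime_iff_eq hp hN).mp ((Dvd.intro _ rfl).trans this)
    subst hpN
    have h3 := Nat.le_of_dvd hp.pos this
    nlinarith [hp.two_le]
  have hco2 : IsCoprime (2 : ℤ) (z ^ 2) := by
    refine ⟨-((z ^ 2 - 1) / 2), 1, ?_⟩
    obtain ⟨j, rfl⟩ : ∃ j, z = 2 * j + 1 := ⟨z / 2, by omega⟩
    have : (2 * j + 1) ^ 2 - 1 = 2 * (2 * j ^ 2 + 2 * j) := by ring
    rw [this, Int.mul_ediv_cancel_left _ (by norm_num)]; ring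
  obtain ⟨r, s, hrs⟩ := hco
  obtain ⟨t, u, htu⟩ := hco2
  have hw := sqrtd_sq (N := N)
  set w : ℤ√(-(N : ℤ)) := Zsqrtd.sqrtd with hwdef
  have hxz' : (2 * z ^ 2 : ℤ√(-(N : ℤ))) = x ^ 2 + N := by exact_mod_cast congrArg (Int.cast) hxz
  have hrs' : (r * z + s * (2 * x) : ℤ√(-(N : ℤ))) = 1 := by exact_mod_cast congrArg (Int.cast) hrs
  have htu' : (t * 2 + u * z ^ 2 : ℤ√(-(N : ℤ))) = 1 := by exact_mod_cast congrArg (Int.cast) htu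
  refine ⟨span {(z : ℤ√(-(N : ℤ))), x + w}, ?_⟩
  have e1 : span {(z : ℤ√(-(N : ℤ))), x + w} * span {(z : ℤ√(-(N : ℤ))), x + w} =
      span {(z ^ 2 : ℤ√(-(N : ℤ))), x + w} := by
    rw [span_pair_mul_span_pair]
    apply le_antisymm
    · rw [span_le]
      rintro y (rfl | rfl | rfl | rfl) <;> rw [SetLike.mem_coe, mem_span_pair]
      · exact ⟨1, 0, by ring⟩
      · exact ⟨0, z, by ring⟩
      · exact ⟨0, z, by ring⟩
      · exact ⟨0, x + w, by ring⟩
    · set M : Ideal (ℤ√(-(N : ℤ))) := span {_, _, _, _}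
      have m1 : (z * z : ℤ√(-(N : ℤ))) ∈ M := subset_span (by simp)
      have m2 : (z * (x + w) : ℤ√(-(N : ℤ))) ∈ M := subset_span (by simp)
      have m3 : ((x + w) * (x + w) : ℤ√(-(N : ℤ))) ∈ M := subset_span (by simp)
      rw [span_le]
      rintro y (rfl | rfl)
      · rw [pow_two]; exact m1
      · have := M.add_mem (M.mul_mem_left r m2) (M.mul_mem_left s
          (M.add_mem m3 (M.mul_mem_left 2 m1)))
        have e : (x + w : ℤ√(-(N : ℤ))) =
            r * (z * (x + w)) + s * ((x + w) * (x + w) + 2 * (z * z)) := by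
          linear_combination -(x + w) * hrs' - s * hw - s * hxz'
        rw [← e] at this
        exact this
  rw [e1, pTwo_eq x hx, span_pair_mul_span_pair]
  apply le_antisymm
  · rw [span_le]
    rintro y (rfl | rfl | rfl | rfl) <;> rw [SetLike.mem_coe, mem_span_singleton]
    · exact ⟨x - w, by linear_combination hxz' + hw⟩
    · exact ⟨z ^ 2, by ring⟩
    · exact ⟨2, by ring⟩
    · exact ⟨x + w, by ring⟩
  · set M : Ideal (ℤ√(-(N : ℤ))) := span {_, _, _, _}
    have m1 : (z ^ 2 * (x + w) : ℤ√(-(N : ℤ))) ∈ M := subset_span (by simp [w])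
    have m2 : ((x + w) * 2 : ℤ√(-(N : ℤ))) ∈ M := subset_span (by simp [w])
    rw [span_singleton_le_iff_mem]
    have := M.add_mem (M.mul_mem_left t m2) (M.mul_mem_left u m1)
    have e : (x + w : ℤ√(-(N : ℤ))) = t * ((x + w) * 2) + u * (z ^ 2 * (x + w)) := by
      linear_combination -(x + w) * htu'
    rw [← e] at this
    exact this

end aux

section aux2
open Ideal

theorem pairSpan_prim {N : ℕ} (J : Ideal (ℤ√(-(N : ℤ)))) (hJ : conjI J = J) (b : ℤ)
    (hb : (b : ℤ√(-(N : ℤ))) + Zsqrtd.sqrtd ∈ J) :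
    ∃ a : ℕ, a ∣ 2 * N ∧ (a : ℤ) ∣ b ^ 2 + N ∧
      J = span {(a : ℤ√(-(N : ℤ))), (b : ℤ√(-(N : ℤ))) + Zsqrtd.sqrtd} := by
  have hw := sqrtd_sq (N := N)
  have hc : (b : ℤ√(-(N : ℤ))) - Zsqrtd.sqrtd ∈ J := by
    rw [← hJ, mem_conjI]
    convert hb using 1
    ext <;> simp
  set w : ℤ√(-(N : ℤ)) := Zsqrtd.sqrtd with hwdef
  obtain ⟨a0, ha0⟩ := (IsPrincipalIdealRing.principal (J.comap (Int.castRingHom (ℤ√(-(N : ℤ))))))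
  have key : ∀ n : ℤ, (n : ℤ√(-(N : ℤ))) ∈ J ↔ ((a0.natAbs : ℕ) : ℤ) ∣ n := by
    intro n
    have h : n ∈ J.comap (Int.castRingHom (ℤ√(-(N : ℤ)))) ↔ n ∈ Submodule.span ℤ {a0} := by
      rw [ha0]
    rw [Ideal.mem_comap] at h
    rw [Int.natAbs_dvd, ← Ideal.mem_span_singleton]
    simpa using h
  refine ⟨a0.natAbs, ?_, ?_, ?_⟩
  · rw [← Int.natCast_dvd_natCast, ← key]
    have := J.mul_mem_left (-w) (J.sub_mem hb hc)
    convert this using 1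
    push_cast
    linear_combination 2 * hw
  · rw [← key]
    have := J.mul_mem_left ((b : ℤ√(-(N : ℤ))) + w) hc
    convert this using 1
    push_cast
    linear_combination hw
  · apply le_antisymm
    · intro x hx
      have hxe : x = (x.re : ℤ√(-(N : ℤ))) + x.im * w := by
        ext <;> simp [hwdef]
      have hm : ((x.re - x.im * b : ℤ) : ℤ√(-(N : ℤ))) ∈ J := by
        have := J.sub_mem hx (J.mul_mem_left (x.im : ℤ√(-(N : ℤ))) hb)
        have e : ((x.re - x.im * b : ℤ) : ℤ√(-(N : ℤ))) = x - x.im * (b + w) := by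
          push_cast; linear_combination -hxe
        rw [e]; exact this
      rw [key] at hm
      obtain ⟨k, hk⟩ := hm
      rw [mem_span_pair]
      refine ⟨k, x.im, ?_⟩
      have hk' : ((x.re : ℤ√(-(N : ℤ))) - x.im * b) = (a0.natAbs : ℕ) * k := by
        have := congrArg (Int.cast : ℤ → ℤ√(-(N : ℤ))) hk
        rw [Int.cast_sub, Int.cast_mul, Int.cast_mul, Int.cast_natCast] at this
        exact this
      linear_combination -hxe - hk'
    · rw [span_le]
      rintro y (rfl | rfl)
      · have := (key (a0.natAbs : ℕ)).mpr (dvd_refl _)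
        simpa using this
      · exact hb

theorem prim_cases {N : ℕ} (hN : N.Prime) (h1 : N % 8 = 1) (J : Ideal (ℤ√(-(N : ℤ))))
    (hJ : conjI J = J) (b : ℤ) (hb : (b : ℤ√(-(N : ℤ))) + Zsqrtd.sqrtd ∈ J) :
    ∃ g, J = span {g} ∨ J = span {g} * pTwo N := by
  obtain ⟨a, ha, hab, hJe⟩ := pairSpan_prim J hJ b hb
  have hw := sqrtd_sq (N := N)
  obtain ⟨d, e, hd, he, rfl⟩ := (Nat.dvd_mul.mp ha)
  have hNodd : (N : ℤ) % 2 = 1 := by omega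
  have hodd : 2 ∣ b ^ 2 + (N : ℤ) → b % 2 = 1 := by
    intro h
    rcases Int.emod_two_eq_zero_or_one b with h' | h'
    · obtain ⟨k, rfl⟩ := Int.dvd_of_emod_eq_zero h'
      ring_nf at h; omega
    · exact h'
  have hNb : (N : ℤ) ∣ b ^ 2 + (N : ℤ) → (N : ℤ) ∣ b := by
    intro h
    exact (Nat.prime_iff_prime_int.mp hN).dvd_of_dvd_pow ((Int.dvd_add_left (dvd_refl _)).mp h)
  rcases (Nat.dvd_prime Nat.prime_two).mp hd with rfl | rfl <;>
    rcases (Nat.dvd_prime hN).mp he with rfl | rfl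
  · refine ⟨1, Or.inl ?_⟩
    rw [hJe, Ideal.span_singleton_one, Ideal.eq_top_iff_one]
    exact subset_span (by simp)
  · obtain ⟨c, rfl⟩ := hNb (by simpa using hab)
    refine ⟨Zsqrtd.sqrtd, Or.inl ?_⟩
    rw [hJe]
    set w : ℤ√(-(e : ℤ)) := Zsqrtd.sqrtd with hwdef
    apply le_antisymm
    · rw [span_le]
      rintro y (rfl | rfl) <;> rw [SetLike.mem_coe, mem_span_singleton]
      · exact ⟨-w, by push_cast; linear_combination hw⟩
      · exact ⟨1 - c * w, by push_cast; linear_combination c * hw⟩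
    · rw [span_singleton_le_iff_mem, mem_span_pair]
      exact ⟨-c, 1, by push_cast; ring⟩
  · refine ⟨1, Or.inr ?_⟩
    rw [Ideal.span_singleton_one, Ideal.top_mul, pTwo_eq b (hodd (by simpa using hab)), hJe]
    simp
  · obtain ⟨c, rfl⟩ := hNb ((Dvd.intro_left _ (by push_cast; rfl)).trans hab)
    have hbo := hodd ((Dvd.intro _ (by push_cast; rfl)).trans hab)
    obtain ⟨j, rfl⟩ : ∃ j, c = 2 * j + 1 := by
      refine ⟨c / 2, ?_⟩
      rw [Int.mul_emod, hNodd] at hbo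
      omega
    refine ⟨Zsqrtd.sqrtd, Or.inr ?_⟩
    rw [hJe, pTwo, Ideal.span_mul_span']
    set w : ℤ√(-(e : ℤ)) := Zsqrtd.sqrtd with hwdef
    rw [Set.singleton_mul, Set.image_pair]
    apply le_antisymm
    · rw [span_le]
      rintro y (rfl | rfl) <;> rw [SetLike.mem_coe, mem_span_pair]
      · exact ⟨-w, 0, by push_cast; linear_combination -2 * hw⟩
      · exact ⟨-j * w + 1, -1, by push_cast; linear_combination (-2 * j - 1) * hw⟩
    · rw [span_le]
      rintro y (rfl | rfl) <;> rw [SetLike.mem_coe, mem_span_pair]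
      · exact ⟨-(2 * j + 1), 2, by push_cast; ring⟩
      · exact ⟨-j - 1, 1, by push_cast; linear_combination -hw⟩

theorem ambig_cases {N : ℕ} [IsDedekindDomain (ℤ√(-(N : ℤ)))] (hN : N.Prime) (h1 : N % 8 = 1)
    (J : Ideal (ℤ√(-(N : ℤ)))) (hJ0 : J ≠ ⊥) (hJ : conjI J = J) :
    ∃ g, J = span {g} ∨ J = span {g} * pTwo N := by
  let G : Ideal ℤ :=
    { carrier := {n | ∃ x ∈ J, x.im = n}
      add_mem' := by
        rintro _ _ ⟨x, hx, rfl⟩ ⟨y, hy, rfl⟩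
        exact ⟨x + y, J.add_mem hx hy, by simp⟩
      zero_mem' := ⟨0, J.zero_mem, by simp⟩
      smul_mem' := by
        rintro c _ ⟨x, hx, rfl⟩
        exact ⟨(c : ℤ√(-(N : ℤ))) * x, J.mul_mem_left _ hx, by simp⟩ }
  obtain ⟨g, hg⟩ := IsPrincipalIdealRing.principal G
  have hgm : ∃ x ∈ J, x.im = g := by
    have : g ∈ G := by rw [hg]; exact Submodule.mem_span_singleton_self g
    exact this
  have him : ∀ x ∈ J, g ∣ x.im := by
    intro x hx
    have : x.im ∈ G := ⟨x, hx, rfl⟩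
    rw [hg] at this
    exact Ideal.mem_span_singleton.mp this
  have hre : ∀ x ∈ J, g ∣ x.re := by
    intro x hx
    have := him _ (J.mul_mem_left Zsqrtd.sqrtd hx)
    simpa using this
  have hle : J ≤ span {(g : ℤ√(-(N : ℤ)))} := by
    intro x hx
    rw [mem_span_singleton, Zsqrtd.intCast_dvd]
    exact ⟨hre x hx, him x hx⟩
  obtain ⟨J', hJ'⟩ := Ideal.dvd_iff_le.mpr hle
  have hg0 : span {(g : ℤ√(-(N : ℤ)))} ≠ ⊥ := by
    intro h; rw [h] at hle; exact hJ0 (le_bot_iff.mp hle)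
  have hg0' : (g : ℤ√(-(N : ℤ))) ≠ 0 := by
    intro h; apply hg0; rw [h]; simp
  have hconj : conjI J' = J' := by
    apply mul_left_cancel₀ hg0
    have h2 : conjI J = span {(g : ℤ√(-(N : ℤ)))} * conjI J' := by
      rw [hJ', conjI_mul, conjI_span]; simp
    rw [← h2, hJ, hJ']
  obtain ⟨x, hx, hxg⟩ := hgm
  obtain ⟨b, hb⟩ := hre x hx
  have hb' : (b : ℤ√(-(N : ℤ))) + Zsqrtd.sqrtd ∈ J' := by
    rw [hJ', Ideal.mem_span_singleton_mul] at hx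
    obtain ⟨y, hy, hyx⟩ := hx
    have : y = (b : ℤ√(-(N : ℤ))) + Zsqrtd.sqrtd := by
      apply mul_left_cancel₀ hg0'
      rw [hyx]
      ext <;> simp [hb, hxg]
    rwa [← this]
  obtain ⟨c, h | h⟩ := prim_cases hN h1 J' hconj b hb'
  · exact ⟨g * c, Or.inl (by rw [hJ', h, span_singleton_mul_span_singleton])⟩
  · exact ⟨g * c, Or.inr (by rw [hJ', h, ← mul_assoc, span_singleton_mul_span_singleton])⟩

theorem ideal_sqrt_unique {R : Type*} [CommRing R] [IsDedekindDomain R] (A B : Ideal R)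
    (hA : A ≠ ⊥) (h : A * A = B * B) : A = B := by
  have hB : B ≠ ⊥ := by
    rintro rfl; apply hA; simpa using h
  have hs : A ⊔ B ≠ ⊥ := fun h' => hA (by
    rw [← le_bot_iff, ← h']; exact le_sup_left)
  have e1 : (A ⊔ B) * (A ⊔ B) = A * (A ⊔ B) := by
    rw [Ideal.sup_mul, Ideal.mul_sup, Ideal.mul_sup, ← h, mul_comm B A]
    apply le_antisymm
    · exact sup_le le_rfl (sup_le le_sup_right le_sup_left)
    · exact le_sup_left
  have e2 : (A ⊔ B) * (A ⊔ B) = B * (A ⊔ B) := by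
    rw [Ideal.sup_mul, Ideal.mul_sup, Ideal.mul_sup, h, mul_comm B A]
    apply le_antisymm
    · exact sup_le (sup_le le_sup_right le_sup_left) le_rfl
    · exact le_sup_right
  exact mul_right_cancel₀ hs (e1.symm.trans e2)

theorem two_torsion {N : ℕ} [IsDedekindDomain (ℤ√(-(N : ℤ)))] (hN : N.Prime) (h1 : N % 8 = 1)
    (I : Ideal (ℤ√(-(N : ℤ)))) (hI0 : I ≠ ⊥) (β : ℤ√(-(N : ℤ))) (hI : I * I = span {β}) :
    ∃ c g, c ≠ 0 ∧ (span {c} * I = span {g} ∨ span {c} * I = span {g} * pTwo N) := by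
  set m := absNorm I with hm
  have hm0 : m ≠ 0 := by rw [hm, Ne, absNorm_eq_zero_iff]; exact hI0
  have hnn : 0 ≤ β.norm := by
    rw [Zsqrtd.norm_def]; nlinarith [mul_self_nonneg β.re, mul_self_nonneg β.im, 
      mul_nonneg (Int.natCast_nonneg N) (mul_self_nonneg β.im)]
  have hmn : β.norm = m * m := by
    have : m * m = β.norm.natAbs := by rw [hm, ← map_mul, hI, absNorm_span']
    have : ((m * m : ℕ) : ℤ) = β.norm := by rw [this]; exact Int.natAbs_of_nonneg hnn
    rw [← this]; push_cast; rfl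
  have hββ : β * star β = (m : ℤ√(-(N : ℤ))) * m := by
    rw [← Zsqrtd.norm_eq_mul_conj, hmn]; push_cast; rfl
  have hmR : (m : ℤ√(-(N : ℤ))) ≠ 0 := by
    intro h
    have := congrArg Zsqrtd.re h
    simp at this; exact hm0 this
  have hmS : span {(m : ℤ√(-(N : ℤ)))} ≠ ⊥ := by
    rw [Ne, Ideal.span_singleton_eq_bot]; exact hmR
  have hIc : I * conjI I = span {(m : ℤ√(-(N : ℤ)))} := by
    symm
    apply ideal_sqrt_unique _ _ hmS
    rw [mul_mul_mul_comm, ← conjI_mul, hI, conjI_span, span_singleton_mul_span_singleton,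
      span_singleton_mul_span_singleton, hββ]
  have hmc : span {(m : ℤ√(-(N : ℤ)))} * conjI I = span {star β} * I := by
    apply mul_left_cancel₀ hI0
    calc I * (span {(m : ℤ√(-(N : ℤ)))} * conjI I)
        = span {(m : ℤ√(-(N : ℤ)))} * (I * conjI I) := by ring
      _ = span {β} * span {star β} := by
        rw [hIc, span_singleton_mul_span_singleton, span_singleton_mul_span_singleton, hββ]
      _ = I * (span {star β} * I) := by rw [← hI]; ring
  by_cases h0 : (m : ℤ√(-(N : ℤ))) + star β = 0
  · have hs : star β = -(m : ℤ√(-(N : ℤ))) := by linear_combination h0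
    have : conjI I = I := by
      rw [hs, Ideal.span_singleton_neg] at hmc
      exact mul_left_cancel₀ hmS hmc
    obtain ⟨g, hg⟩ := ambig_cases hN h1 I hI0 this
    exact ⟨1, g, one_ne_zero, by simpa using hg⟩
  · have hc : conjI (span {(m : ℤ√(-(N : ℤ))) + star β} * I) =
        span {(m : ℤ√(-(N : ℤ))) + star β} * I := by
      apply mul_left_cancel₀ hmS
      have hst : star ((m : ℤ√(-(N : ℤ))) + star β) = m + β := by simp
      rw [conjI_mul, conjI_span, hst, mul_left_comm, hmc, ← mul_assoc, ← mul_assoc,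
        span_singleton_mul_span_singleton, span_singleton_mul_span_singleton]
      congr 3
      linear_combination hββ
    obtain ⟨g, hg⟩ := ambig_cases hN h1 _ (by
      intro h
      rcases Ideal.mul_eq_bot.mp h with h | h
      · exact h0 (Ideal.span_singleton_eq_bot.mp h)
      · exact hI0 h) hc
    exact ⟨_, g, h0, hg⟩

end aux2

theorem group_end {G : Type*} [CommGroup G] (c : G) (hc : c ≠ 1) (hcc : c * c = 1)
    (h : ∀ x : G, x * x = 1 → x = 1 ∨ x = c) (y : G) (hy : y * y * c = 1) :
    Nat.card {x : G // x ^ 2 = 1} = 2 ∧ 4 ∣ Nat.card G := by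
  constructor
  · have : {x : G | x ^ 2 = 1} = {1, c} := by
      ext x
      simp only [Set.mem_ofPred_eq, Set.mem_insert_iff, Set.mem_singleton_iff, pow_two]
      constructor
      · exact h x
      · rintro (rfl | rfl)
        · simp
        · exact hcc
    change Nat.card ({x : G | x ^ 2 = 1} : Set G) = 2
    rw [this, Nat.card_coe_set_eq, Set.ncard_pair hc.symm]
  · have hyc : y * y = c := by
      have := mul_right_cancel (hy.trans hcc.symm); exact this
    have : orderOf y = 2 ^ (1 + 1) := by
      apply orderOf_eq_prime_pow
      · rw [pow_one, pow_two, hyc]; exact hc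
      · have : y ^ (2 ^ (1 + 1)) = (y * y) * (y * y) := by
          rw [← pow_two, ← pow_two, ← pow_mul]; norm_num
        rw [this, hyc, hcc]
    have h4 := orderOf_dvd_natCard y
    rw [this] at h4
    exact h4

open Ideal nonZeroDivisors in
theorem zsqrtd_main {N : ℕ} [IsDedekindDomain (ℤ√(-(N : ℤ)))] (hN : N.Prime) (h1 : N % 8 = 1) :
    Nat.card {x : ClassGroup (ℤ√(-(N : ℤ))) // x ^ 2 = 1} = 2 ∧
      4 ∣ Nat.card (ClassGroup (ℤ√(-(N : ℤ)))) := by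
  have h2 : (2 : ℤ√(-(N : ℤ))) ≠ 0 := by
    intro h
    have := congrArg Zsqrtd.re h
    simp at this
  have hp0 : pTwo N ≠ ⊥ := by
    intro h
    have := pTwo_sq h1
    rw [h, Ideal.bot_mul, eq_comm, Ideal.span_singleton_eq_bot] at this
    exact h2 this
  let P : (Ideal (ℤ√(-(N : ℤ))))⁰ := ⟨pTwo N, mem_nonZeroDivisors_of_ne_zero hp0⟩
  have mk1 : ∀ (A : (Ideal (ℤ√(-(N : ℤ))))⁰) (g : ℤ√(-(N : ℤ))),
      (A : Ideal (ℤ√(-(N : ℤ)))) = span {g} → ClassGroup.mk0 A = 1 := by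
    intro A g hA
    exact (ClassGroup.mk0_eq_one_iff A.2).mpr ⟨g, hA⟩
  obtain ⟨x, z, hxz⟩ := aux_thue N hN h1
  obtain ⟨I, hI⟩ := aux_square hN h1 x z hxz
  have hxw : ((x : ℤ√(-(N : ℤ))) + Zsqrtd.sqrtd) ≠ 0 := by
    intro h
    have := congrArg Zsqrtd.im h
    simp at this
  have hI0 : I ≠ ⊥ := by
    rintro rfl
    rw [Ideal.bot_mul, Ideal.bot_mul, eq_comm, Ideal.span_singleton_eq_bot] at hI
    exact hxw hI
  let I' : (Ideal (ℤ√(-(N : ℤ))))⁰ := ⟨I, mem_nonZeroDivisors_of_ne_zero hI0⟩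
  refine group_end (ClassGroup.mk0 P) ?_ ?_ ?_ (ClassGroup.mk0 I') ?_
  · intro h
    obtain ⟨g, hg⟩ := (ClassGroup.mk0_eq_one_iff P.2).mp h
    exact pTwo_not_principal hN h1 g hg
  · rw [← map_mul]
    exact mk1 _ 2 (pTwo_sq h1)
  · intro X hX
    obtain ⟨A, rfl⟩ := ClassGroup.mk0_surjective X
    rw [← map_mul] at hX
    obtain ⟨β, hβ⟩ := (ClassGroup.mk0_eq_one_iff (A * A).2).mp hX
    obtain ⟨c, g, hc, hcg⟩ := two_torsion hN h1 A (nonZeroDivisors.coe_ne_zero A) β hβ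
    rcases hcg with hcg | hcg
    · left
      rw [← map_one ClassGroup.mk0, ClassGroup.mk0_eq_mk0_iff]
      refine ⟨c, g, hc, ?_, by simpa using hcg⟩
      rintro rfl
      rw [Ideal.span_singleton_zero, Ideal.mul_eq_bot] at hcg
      rcases hcg with h | h
      · exact hc (Ideal.span_singleton_eq_bot.mp h)
      · exact nonZeroDivisors.coe_ne_zero A h
    · right
      rw [ClassGroup.mk0_eq_mk0_iff]
      refine ⟨c, g, hc, ?_, hcg⟩
      rintro rfl
      rw [Ideal.span_singleton_zero, Ideal.bot_mul, Ideal.mul_eq_bot] at hcg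
      rcases hcg with h | h
      · exact hc (Ideal.span_singleton_eq_bot.mp h)
      · exact nonZeroDivisors.coe_ne_zero A h
  · rw [← map_mul, ← map_mul]
    exact mk1 _ _ hI

theorem dedekind_of_equiv {R S : Type*} [CommRing R] [CommRing S] [IsDedekindDomain S]
    (e : R ≃+* S) : IsDedekindDomain R := by
  have : IsDomain R := e.toMulEquiv.isDomain S
  have : IsNoetherianRing R := isNoetherianRing_of_ringEquiv S e.symm
  have : IsIntegrallyClosed R := IsIntegrallyClosed.of_equiv e.symm
  have : Ring.DimensionLEOne R := by
    refine ⟨fun {p} hp0 hp => ?_⟩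
    have hq : (p.comap e.symm).IsPrime := Ideal.comap_isPrime _ _
    have hq0 : p.comap e.symm ≠ ⊥ := by
      intro h
      apply hp0
      rw [eq_bot_iff]
      intro x hx
      have : e x ∈ p.comap e.symm := by simpa [Ideal.mem_comap] using hx
      rw [h] at this
      simpa using this
    have hm : (p.comap e.symm).IsMaximal := hq.isMaximal hq0
    have : p = (p.comap e.symm).comap e := by
      ext x; simp [Ideal.mem_comap]
    rw [this]
    exact Ideal.comap_isMaximal_of_equiv e
  exact {}

/-- If `N ≡ 1 (mod 8)` is prime and `K = ℚ(√−N)`, then the 2-primary part of `Cl(K)` is cyclic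
of order at least 4: `Cl(K)` has exactly two elements squaring to the identity, and 4 divides
the class number `h(−N)`. -/
theorem classGroup_two_part_cyclic_of_one_mod_eight
    (N : ℕ) (hN : N.Prime) (h1 : N % 8 = 1)
    (K : Type) [Field K] [NumberField K]
    (α : K) (hα : α ^ 2 = -(N : K)) (hgen : Algebra.adjoin ℚ {α} = ⊤) :
    Nat.card {x : ClassGroup (𝓞 K) // x ^ 2 = 1} = 2 ∧
      4 ∣ Nat.card (ClassGroup (𝓞 K)) := by
  obtain ⟨e⟩ := aux_equiv N hN h1 K α hα hgen
  have : IsDedekindDomain (ℤ√(-(N : ℤ))) := dedekind_of_equiv e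
  obtain ⟨ha, hb⟩ := zsqrtd_main hN h1
  let f := ClassGroup.mulEquiv e
  rw [Nat.card_congr f.toEquiv] at hb
  refine ⟨?_, hb⟩
  refine Eq.trans ?_ ha
  refine (Nat.card_congr (f.toEquiv.subtypeEquiv fun x => ?_)).symm
  change x ^ 2 = 1 ↔ f x ^ 2 = 1
  rw [← map_pow, EmbeddingLike.map_eq_one_iff]
end

section
/- Let N be an odd prime. Then there exists a modular form g of weight 1 and level Γ₁(4N) whose value at every point τ of the upper half plane is given by the convergent series g(τ) = Σ_{(m,n) ∈ ℤ×ℤ} exp(2πi(m² + Nn²)τ); in particular the q-expansion of g is Σ_{m,n ∈ ℤ} q^{m²+Nn²} with q = e^{2πiτ}. -/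
open Complex CongruenceSubgroup

lemma aux_decomp (d : ℕ) [NeZero d] (b : ℤ) (w : ℂ) (hw : 0 < w.im) :
    jacobiTheta₂ 0 (2 * ((b:ℂ) / d + w)) =
      ∑ r : Fin d, Complex.exp (2 * Real.pi * I * (b * (r:ℕ) ^ 2 / d)) *
        (Complex.exp (2 * Real.pi * I * ((r:ℕ) ^ 2 * w)) *
          jacobiTheta₂ (2 * d * (r:ℕ) * w) (2 * d ^ 2 * w)) := by
  have hd : (d:ℂ) ≠ 0 := Nat.cast_ne_zero.mpr (NeZero.ne d)
  have him : 0 < (2 * ((b:ℂ) / d + w)).im := by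
    have : (2 * ((b:ℂ) / d + w)) = ((2 * b / d : ℝ) : ℂ) + (2:ℝ) * w := by push_cast; ring
    rw [this, add_im, ofReal_im, im_ofReal_mul]
    linarith
  have hs := (summable_jacobiTheta₂_term_iff 0 _).mpr him
  have hs' := (Int.divModEquiv d).symm.summable_iff.mpr hs
  have hs'' := (Equiv.prodComm (Fin d) ℤ).summable_iff.mpr hs'
  rw [jacobiTheta₂, ← (Int.divModEquiv d).symm.tsum_eq, ← (Equiv.prodComm (Fin d) ℤ).tsum_eq]
  refine (Summable.tsum_prod hs'').trans ?_
  rw [tsum_fintype]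
  refine Finset.sum_congr rfl fun r _ => ?_
  rw [jacobiTheta₂, ← tsum_mul_left, ← tsum_mul_left]
  refine tsum_congr fun m => ?_
  simp only [Function.comp_apply, Equiv.prodComm_apply, Prod.swap_prod_mk, jacobiTheta₂_term, ← Complex.exp_add,
    Int.divModEquiv]
  simp only [Equiv.coe_fn_symm_mk]
  rw [Complex.exp_eq_exp_iff_exists_int]
  refine ⟨b * d * m^2 + 2 * b * m * r, ?_⟩
  push_cast
  field_simp
  ring

lemma aux_gauss_shift (d : ℕ) [NeZero d] (b c m : ℤ) (h : (-(4 * b * c) : ZMod d) = 1) :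
    ∑ r : Fin d, Complex.exp (2 * Real.pi * I * (b * (r:ℕ) ^ 2 / d)) *
       Complex.exp (2 * Real.pi * I * ((m * (r:ℕ) - c * m ^ 2) / d)) =
    ∑ x : ZMod d, ZMod.stdAddChar (b * x ^ 2 : ZMod d) := by
  have h1 : ∀ r : Fin d, Complex.exp (2 * Real.pi * I * (b * (r:ℕ) ^ 2 / d)) *
       Complex.exp (2 * Real.pi * I * ((m * (r:ℕ) - c * m ^ 2) / d)) =
       ZMod.stdAddChar (b * ((ZMod.finEquiv d r : ZMod d) - 2 * c * m) ^ 2 : ZMod d) := by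
    intro r
    have e1 : (ZMod.finEquiv d r : ZMod d) = ((r : ℕ) : ZMod d) := by
      obtain _ | k := d
      · exact r.elim0
      · exact (Fin.cast_val_eq_self r).symm
    have e2 : (b * ((ZMod.finEquiv d r : ZMod d) - 2 * c * m) ^ 2 : ZMod d) =
       ((b * (r:ℕ) ^ 2 + m * (r : ℕ) - c * m ^ 2 : ℤ) : ZMod d) := by
      rw [e1]; push_cast
      linear_combination ((r : ℕ) * m - c * m ^ 2 : ZMod d) * h
    rw [e2, ZMod.stdAddChar_coe, ← Complex.exp_add]
    congr 1; push_cast; ring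
  rw [Finset.sum_congr rfl fun r _ => h1 r]
  exact Fintype.sum_equiv ((ZMod.finEquiv d).toEquiv.trans (Equiv.subRight (2 * c * m : ZMod d))) _ _
    (fun r => rfl)

lemma aux_theta (d : ℕ) [NeZero d] (b c : ℤ) (h : (-(4 * b * c) : ZMod d) = 1)
    (τ w : ℂ) (hτ : 0 < τ.im) (hw : 0 < w.im) (hwτ : -1 / (2 * d ^ 2 * w) = -(2 * c / d) + -1 / (2 * τ)) :
    jacobiTheta₂ 0 (2 * ((b:ℂ) / d + w)) =
      (∑ x : ZMod d, ZMod.stdAddChar (b * x ^ 2 : ZMod d)) *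
       ((-I * (2 * τ)) ^ (1 / 2 : ℂ) / (-I * (2 * d ^ 2 * w)) ^ (1 / 2 : ℂ)) *
       jacobiTheta₂ 0 (2 * τ) := by
  have hd : (d:ℂ) ≠ 0 := Nat.cast_ne_zero.mpr (NeZero.ne d)
  have hw0 : w ≠ 0 := by rintro rfl; simp at hw
  have hτ0 : τ ≠ 0 := by rintro rfl; simp at hτ
  have him : 0 < (-1 / (2 * τ)).im := by
    have : (-1 / (2 * τ)) = ((-1/2 : ℝ) : ℂ) * τ⁻¹ := by push_cast; field_simp
    rw [this, im_ofReal_mul, inv_im]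
    have := normSq_pos.mpr hτ0
    have := div_pos hτ this
    rw [neg_div (normSq τ)]
    linarith
  rw [aux_decomp d b w hw]
  have h1 : ∀ r : Fin d, Complex.exp (2 * Real.pi * I * ((r:ℕ) ^ 2 * w)) *
          jacobiTheta₂ (2 * d * (r:ℕ) * w) (2 * d ^ 2 * w) =
        1 / (-I * (2 * d ^ 2 * w)) ^ (1 / 2 : ℂ) *
         ∑' m : ℤ, Complex.exp (2 * Real.pi * I * ((m * (r:ℕ) - c * m ^ 2) / d)) *
           jacobiTheta₂_term m 0 (-1 / (2 * τ)) := by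
    intro r
    rw [jacobiTheta₂_functional_equation, hwτ, jacobiTheta₂, ← tsum_mul_left, ← tsum_mul_left,
      ← tsum_mul_left]
    refine tsum_congr fun m => ?_
    simp only [jacobiTheta₂_term]
    rw [mul_left_comm, mul_assoc, mul_assoc, ← Complex.exp_add, ← Complex.exp_add, ← Complex.exp_add]
    congr 2
    field_simp
    ring
  have hs := (summable_jacobiTheta₂_term_iff 0 _).mpr him
  have hs2 : ∀ r : Fin d, Summable fun m : ℤ =>
      Complex.exp (2 * Real.pi * I * ((m * (r:ℕ) - c * m ^ 2) / d)) *
           jacobiTheta₂_term m 0 (-1 / (2 * τ)) := by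
    intro r
    refine Summable.of_norm_bounded hs.norm fun m => ?_
    rw [norm_mul]
    have : (2 * Real.pi * I * ((m * (r:ℕ) - c * m ^ 2) / d) : ℂ) =
      ((2 * Real.pi * ((m * (r:ℕ) - c * m ^ 2) / d) : ℝ) : ℂ) * I := by push_cast; ring
    rw [this, norm_exp_ofReal_mul_I, one_mul]
  simp_rw [h1]
  have h2 := jacobiTheta₂_functional_equation 0 (2 * τ)
  simp only [zero_div, ne_eq, OfNat.ofNat_ne_zero, not_false_eq_true, zero_pow, mul_zero,
    Complex.exp_zero, mul_one] at h2
  have h3 : (-I * (2 * τ)) ^ (1 / 2 : ℂ) ≠ 0 := by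
    rw [Ne, cpow_eq_zero_iff]
    simp [hτ0]
  rw [h2, jacobiTheta₂]
  have h4 : ∀ G A B T : ℂ, A ≠ 0 → G * (A / B) * (1 / A * T) = 1 / B * (G * T) := by
    intro G A B T hA; field_simp
  rw [h4 _ _ _ _ h3, ← tsum_mul_left]
  simp_rw [mul_left_comm _ (1 / (-I * (2 * (d:ℂ) ^ 2 * w)) ^ (1 / 2 : ℂ)), ← Finset.mul_sum]
  congr 1
  simp_rw [← tsum_mul_left]
  rw [← Summable.tsum_finsetSum (fun r _ => (hs2 r).mul_left _)]
  refine tsum_congr fun m => ?_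
  rw [← aux_gauss_shift d b c m h, Finset.sum_mul]
  exact Finset.sum_congr rfl fun r _ => by ring


lemma gauss_eval (p : ℕ) [Fact p.Prime] (hp : p ≠ 2) (a : ZMod p) (ha : a ≠ 0) :
    ∑ x : ZMod p, ZMod.stdAddChar (a * x ^ 2 : ZMod p) =
      ((quadraticChar (ZMod p) a : ℤ) : ℂ) *
        gaussSum ((quadraticChar (ZMod p)).ringHomComp (Int.castRingHom ℂ)) ZMod.stdAddChar := by
  classical
  have hF : ringChar (ZMod p) ≠ 2 := (ZMod.ringChar_zmod_n p).substr hp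
  have h1 : ∑ x : ZMod p, ZMod.stdAddChar (a * x ^ 2 : ZMod p) =
      ∑ t : ZMod p, ((quadraticChar (ZMod p) t + 1 : ℤ) : ℂ) * ZMod.stdAddChar (a * t) := by
    rw [← Finset.sum_fiberwise Finset.univ (fun x : ZMod p => x ^ 2)]
    refine Finset.sum_congr rfl fun t _ => ?_
    rw [← quadraticChar_card_sqrts hF t, Finset.sum_congr rfl
      (g := fun _ => ZMod.stdAddChar (a * t))]
    · rw [Finset.sum_const, nsmul_eq_mul]
      congr 2
      congr 1
      ext x; simp
    · intro x hx
      rw [(Finset.mem_filter.mp hx).2]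
  have h2 : ∑ t : ZMod p, ZMod.stdAddChar (a * t) = 0 := by
    have := AddChar.sum_mulShift a (ZMod.isPrimitive_stdAddChar p)
    simpa [ha, mul_comm] using this
  rw [h1]
  push_cast
  simp_rw [add_mul, one_mul, Finset.sum_add_distrib, h2, add_zero]
  have h3 := gaussSum_mulShift_eq ((quadraticChar (ZMod p)).ringHomComp (Int.castRingHom ℂ))
    ZMod.stdAddChar (Units.mk0 a ha)
  have h4 : ((quadraticChar (ZMod p)).ringHomComp (Int.castRingHom ℂ))⁻¹ =
     ((quadraticChar (ZMod p)).ringHomComp (Int.castRingHom ℂ)) :=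
    ((quadraticChar_isQuadratic (ZMod p)).comp _).inv
  rw [h4] at h3
  simpa [gaussSum, AddChar.mulShift_apply] using h3

lemma gauss_prod (N p : ℕ) [Fact p.Prime] (hN : N.Prime) (hodd : N ≠ 2) (hpN : p % (4 * N) = 1)
    (b : ZMod p) (hb : b ≠ 0) :
    (∑ x : ZMod p, ZMod.stdAddChar (b * x ^ 2 : ZMod p)) *
     (∑ x : ZMod p, ZMod.stdAddChar ((N * b) * x ^ 2 : ZMod p)) = p := by
  have : Fact N.Prime := ⟨hN⟩
  have hp4 : p % 4 = 1 := by
    rw [← Nat.mod_mul_right_mod p 4 N, hpN]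
  have hpN' : p % N = 1 := by
    rw [← Nat.mod_mul_left_mod p 4 N, hpN, Nat.mod_eq_of_lt hN.one_lt]
  have hp2 : p ≠ 2 := by rintro rfl; simp at hp4
  have hne : p ≠ N := by rintro rfl; simp at hpN'
  have hN0 : (N : ZMod p) ≠ 0 := by
    have := ZMod.prime_ne_zero p N hne
    exact_mod_cast this
  have hF : ringChar (ZMod p) ≠ 2 := (ZMod.ringChar_zmod_n p).substr hp2
  have hQ : quadraticChar (ZMod p) (N : ZMod p) = 1 := by
    have h1 := legendreSym.quadratic_reciprocity_one_mod_four (p := p) (q := N) hp4 hodd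
    have h2 : legendreSym N p = 1 := by
      rw [legendreSym]
      have : ((p : ℤ) : ZMod N) = 1 := by
        have : ((p : ℕ) : ZMod N) = (1 : ℕ) := by
          rw [ZMod.natCast_eq_natCast_iff, Nat.ModEq, hpN', Nat.mod_eq_of_lt hN.one_lt]
        simpa using this
      rw [this, map_one]
    rw [h2, legendreSym] at h1
    simpa using h1.symm
  rw [gauss_eval p hp2 b hb, gauss_eval p hp2 _ (mul_ne_zero hN0 hb), map_mul, hQ, one_mul]
  have hsq := quadraticChar_sq_one hb
  have hg := gaussSum_sq (χ := (quadraticChar (ZMod p)).ringHomComp (Int.castRingHom ℂ))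
    (ψ := ZMod.stdAddChar) ?_ ((quadraticChar_isQuadratic (ZMod p)).comp _)
     (ZMod.isPrimitive_stdAddChar p)
  · have h1 : quadraticChar (ZMod p) (-1) = 1 := by
      have := legendreSym.at_neg_one hp2
      rw [legendreSym, ZMod.χ₄_nat_one_mod_four hp4] at this
      simpa using this
    rw [MulChar.ringHomComp_apply, h1, ZMod.card] at hg
    rw [mul_mul_mul_comm, ← pow_two, ← pow_two, hg]
    rw [← Int.cast_pow, hsq]
    simp
  · have := quadraticChar_ne_one hF
    intro h
    apply this
    ext x
    have := DFunLike.congr_fun h (x : ZMod p)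
    simpa using this

/-- The product of theta functions. -/
noncomputable def thF (N : ℕ) (τ : ℂ) : ℂ :=
  jacobiTheta₂ 0 (2 * τ) * jacobiTheta₂ 0 (2 * (N * τ))

lemma sqrt_nat_mul (N : ℕ) (hN : N ≠ 0) (z : ℂ) (hz : z ≠ 0) :
    ((N : ℂ) * z) ^ (1 / 2 : ℂ) = (N : ℂ) ^ (1 / 2 : ℂ) * z ^ (1 / 2 : ℂ) := by
  have hN' : (N : ℂ) ≠ 0 := Nat.cast_ne_zero.mpr hN
  have h0 : (0:ℝ) < N := by positivity
  rw [cpow_def_of_ne_zero (mul_ne_zero hN' hz), cpow_def_of_ne_zero hN', cpow_def_of_ne_zero hz,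
    ← Complex.exp_add]
  congr 1
  have := log_ofReal_mul h0 hz
  rw [ofReal_log h0.le] at this
  push_cast at this
  rw [this]
  ring

lemma sqrt_sq (z : ℂ) : z ^ (1 / 2 : ℂ) * z ^ (1 / 2 : ℂ) = z := by
  rw [← pow_two, one_div]
  exact_mod_cast cpow_nat_inv_pow z two_ne_zero

lemma thF_prime (N p : ℕ) (hp : p.Prime) (hN : N.Prime) (hodd : N ≠ 2) (hpN : p % (4 * N) = 1)
    (a b c : ℤ) (hdet : a * p - b * (4 * N * c) = 1) (τ : ℂ) (hτ : 0 < τ.im) :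
    thF N ((a * τ + b) / ((4 * N * c : ℤ) * τ + p)) = ((4 * N * c : ℤ) * τ + p) * thF N τ := by
  have : Fact p.Prime := ⟨hp⟩
  have hp0 : (p : ℂ) ≠ 0 := Nat.cast_ne_zero.mpr hp.ne_zero
  have hp0' : (0:ℝ) < p := Nat.cast_pos.mpr hp.pos
  have hN0 : (N : ℂ) ≠ 0 := Nat.cast_ne_zero.mpr hN.ne_zero
  have hN0' : (0:ℝ) < N := Nat.cast_pos.mpr hN.pos
  have hτ0 : τ ≠ 0 := by rintro rfl; simp at hτ
  set D : ℂ := (4 * N * c : ℤ) * τ + p with hD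
  have hD0 : D ≠ 0 := by
    intro h
    have h1 := congrArg im h
    have h2 := congrArg re h
    simp only [hD, add_im, add_re, natCast_im, natCast_re, zero_im, zero_re] at h1 h2
    rw [← ofReal_intCast, im_ofReal_mul, add_zero] at h1
    rw [← ofReal_intCast, re_ofReal_mul] at h2
    rcases mul_eq_zero.mp h1 with h | h
    · rw [h] at h2; linarith
    · linarith
  have hdetC : (a : ℂ) * p - b * (4 * N * c) = 1 := by exact_mod_cast hdet
  have hdetZ : (-(b * (4 * N * c)) : ZMod p) = 1 := by
    have := congrArg (Int.cast : ℤ → ZMod p) hdet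
    push_cast at this
    simpa using this
  set w : ℂ := τ / (p * D) with hwdef
  have hw0 : w ≠ 0 := div_ne_zero hτ0 (mul_ne_zero hp0 hD0)
  have hw : 0 < w.im := by
    have h1 : w⁻¹ = ((p * (4 * N * c) : ℝ) : ℂ) + ((p ^ 2 : ℝ) : ℂ) * τ⁻¹ := by
      rw [hwdef, hD]; push_cast; field_simp
    have h2 : (w⁻¹).im < 0 := by
      rw [h1, add_im, ofReal_im, im_ofReal_mul, inv_im, zero_add]
      have := div_pos hτ (normSq_pos.mpr hτ0)
      rw [neg_div]
      have : 0 < (p:ℝ)^2 * (τ.im / normSq τ) := by positivity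
      linarith
    rw [inv_im, neg_div, neg_lt_zero] at h2
    exact (div_pos_iff_of_pos_right (normSq_pos.mpr hw0)).mp h2
  have hb0 : (b : ZMod p) ≠ 0 := by
    intro h; rw [h] at hdetZ; simp at hdetZ
  have hγ : (a * τ + b) / D = b / p + w := by
    rw [hwdef]; field_simp; rw [hD]; push_cast
    linear_combination τ * hdetC
  have t1 := aux_theta p b (N * c) (by rw [← hdetZ]; push_cast; ring) τ w hτ hw
    (by rw [hwdef]; field_simp; rw [hD]; push_cast; ring)
  have t2 := aux_theta p (N * b) c (by rw [← hdetZ]; push_cast; ring) (N * τ) (N * w)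
    (by rw [← ofReal_natCast, im_ofReal_mul]; positivity)
    (by rw [← ofReal_natCast, im_ofReal_mul]; positivity)
    (by rw [hwdef]; field_simp; rw [hD]; push_cast; ring)
  have hG := gauss_prod N p hN hodd hpN b hb0
  rw [thF, thF, hγ, t1]
  rw [show (2 * ((N:ℂ) * (b / p + w))) = 2 * (((N * b : ℤ) : ℂ) / p + N * w) by push_cast; ring, t2]
  rw [show -I * (2 * ((N:ℂ) * τ)) = N * (-I * (2 * τ)) by ring,
    show -I * (2 * (p:ℂ) ^ 2 * (N * w)) = N * (-I * (2 * p ^ 2 * w)) by ring]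
  have e1 : -I * (2 * τ) ≠ 0 := by simp [hτ0]
  have e2 : -I * (2 * (p:ℂ) ^ 2 * w) ≠ 0 := by simp [hp.ne_zero, hw0]
  rw [sqrt_nat_mul N hN.ne_zero _ e1, sqrt_nat_mul N hN.ne_zero _ e2]
  have e3 : (N : ℂ) ^ (1 / 2 : ℂ) ≠ 0 := by rw [Ne, cpow_eq_zero_iff]; simp [hN.ne_zero]
  rw [mul_div_mul_left _ _ e3]
  push_cast
  have hK : (-I * (2 * τ)) ^ (1 / 2 : ℂ) / (-I * (2 * (p:ℂ) ^ 2 * w)) ^ (1 / 2 : ℂ) *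
     ((-I * (2 * τ)) ^ (1 / 2 : ℂ) / (-I * (2 * (p:ℂ) ^ 2 * w)) ^ (1 / 2 : ℂ)) = D / p := by
    rw [div_mul_div_comm, sqrt_sq, sqrt_sq, hwdef]
    have := I_ne_zero
    field_simp
  generalize (-I * (2 * τ)) ^ (1 / 2 : ℂ) / (-I * (2 * (p:ℂ) ^ 2 * w)) ^ (1 / 2 : ℂ) = K at *
  generalize jacobiTheta₂ 0 (2 * τ) = X at *
  generalize jacobiTheta₂ 0 (2 * (N * τ)) = Y at *
  rw [eq_div_iff hp0] at hK
  linear_combination K * K * X * Y * hG + X * Y * hK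

lemma theta_add_int (τ : ℂ) (n : ℤ) : jacobiTheta₂ 0 (2 * (τ + n)) = jacobiTheta₂ 0 (2 * τ) := by
  refine tsum_congr fun m => ?_
  simp only [jacobiTheta₂_term]
  rw [Complex.exp_eq_exp_iff_exists_int]
  refine ⟨m ^ 2 * n, ?_⟩
  push_cast
  ring

lemma thF_add_int (N : ℕ) (τ : ℂ) (n : ℤ) : thF N (τ + n) = thF N τ := by
  rw [thF, thF, theta_add_int, mul_add]
  have := theta_add_int (N * τ) (N * n)
  push_cast at this
  rw [this]

lemma thF_general (N : ℕ) (hN : N.Prime) (hodd : N ≠ 2)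
    (a b c d : ℤ) (hdet : a * d - b * c = 1) (hc : (4 * N : ℤ) ∣ c) (hd : (4 * N : ℤ) ∣ d - 1)
     (τ : ℂ) (hτ : 0 < τ.im) :
    thF N ((a * τ + b) / (c * τ + d)) = (c * τ + d) * thF N τ := by
  have hN2 := hN.two_le
  by_cases hc0 : c = 0
  · subst hc0
    have h1 : a * d = 1 := by linarith
    have h2 : d = 1 := by
      rcases Int.isUnit_iff.mp (IsUnit.of_mul_eq_one (a := d) a (by linarith)) with h | h
      · exact h
      · subst h
        have := Int.le_of_dvd (by norm_num) ((dvd_neg.mpr hd))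
        omega
    subst h2
    obtain rfl : a = 1 := by linarith
    simpa using thF_add_int N τ b
  have : NeZero c.natAbs := ⟨by simpa using hc0⟩
  have hcop : IsUnit ((d : ℤ) : ZMod c.natAbs) := by
    refine IsUnit.of_mul_eq_one (a : ZMod c.natAbs) ?_
    have h0 : ((c : ℤ) : ZMod c.natAbs) = 0 := by
      rw [ZMod.intCast_zmod_eq_zero_iff_dvd]; simp
    have := congrArg (Int.cast : ℤ → ZMod c.natAbs) hdet
    push_cast at this
    rw [h0] at this
    linear_combination this
  obtain ⟨p, -, hp, hpd⟩ := Nat.forall_exists_prime_gt_and_eq_mod hcop 0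
  have h1 : c ∣ p - d := by
    have : ((d : ℤ) : ZMod c.natAbs) = ((p : ℤ) : ZMod c.natAbs) := by simp [hpd]
    rw [ZMod.intCast_eq_intCast_iff_dvd_sub] at this
    simpa using this
  obtain ⟨k, hk⟩ := h1
  obtain ⟨c1, hc1⟩ := hc
  have hpN : p % (4 * N) = 1 := by
    have h2 : (4 * N : ℤ) ∣ p - 1 := by
      have : (p - 1 : ℤ) = (d - 1) + 4 * N * c1 * k := by rw [← hc1]; linarith
      rw [this]
      exact dvd_add hd (by rw [mul_assoc]; exact dvd_mul_right _ _)
    have h3 : (p : ℤ) ≡ 1 [ZMOD (4 * N : ℕ)] := by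
      refine (Int.modEq_iff_dvd.mpr ?_).symm
      exact_mod_cast h2
    have h4 : p ≡ 1 [MOD 4 * N] := by exact_mod_cast h3
    rw [Nat.ModEq] at h4
    rw [h4, Nat.mod_eq_of_lt]
    omega
  have key := thF_prime N p hp hN hodd hpN a (b + k * a) c1
    (by rw [← hc1]; linear_combination hdet + a * hk) (τ - k) (by simpa using hτ)
  rw [← hc1] at key
  have hpc : (p : ℂ) = d + c * k := by
    have : (p : ℤ) = d + c * k := by linarith
    exact_mod_cast this
  have e := thF_add_int N (τ - k) k
  rw [sub_add_cancel] at e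
  rw [← e] at key
  convert key using 2
  · push_cast; rw [hpc]; congr 1 <;> ring
  · rw [hpc]; ring

lemma theta_bound : ∃ C : ℝ, 0 < C ∧ ∀ τ : ℂ, 0 < τ.im →
    ‖jacobiTheta₂ 0 τ‖ ≤ C * √(1 + 1 / τ.im) := by
  have hπ := Real.pi_pos
  have he : Real.exp (-Real.pi) < 1 := by rw [Real.exp_lt_one_iff]; linarith
  set C : ℝ := 1 + 2 / (1 - Real.exp (-Real.pi)) with hC
  have hCpos : 0 < C := by
    have : 0 < 1 - Real.exp (-Real.pi) := by linarith
    positivity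
  have big : ∀ τ : ℂ, 1 ≤ τ.im → ‖jacobiTheta₂ 0 τ‖ ≤ C := by
    intro τ h
    have h0 : 0 < τ.im := by linarith
    have h1 := norm_jacobiTheta_sub_one_le h0
    rw [jacobiTheta_eq_jacobiTheta₂] at h1
    have h2 : Real.exp (-Real.pi * τ.im) ≤ Real.exp (-Real.pi) := by
      apply Real.exp_le_exp.mpr; nlinarith
    have h3 : 2 / (1 - Real.exp (-Real.pi * τ.im)) * Real.exp (-Real.pi * τ.im) ≤
        2 / (1 - Real.exp (-Real.pi)) * 1 := by
      have : 0 < 1 - Real.exp (-Real.pi) := by linarith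
      gcongr
      linarith
    calc ‖jacobiTheta₂ 0 τ‖ = ‖1 + (jacobiTheta₂ 0 τ - 1)‖ := by congr 1; ring
      _ ≤ ‖(1:ℂ)‖ + ‖jacobiTheta₂ 0 τ - 1‖ := norm_add_le _ _
      _ ≤ C := by rw [norm_one, hC]; linarith
  refine ⟨C, hCpos, fun τ hτ => ?_⟩
  have hs1 : 1 ≤ √(1 + 1 / τ.im) := by
    rw [Real.one_le_sqrt]
    have : 0 < 1 / τ.im := by positivity
    linarith
  rcases le_or_gt 1 τ.im with h | h
  · calc _ ≤ C := big τ h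
      _ ≤ _ := le_mul_of_one_le_right hCpos.le hs1
  · set y := τ.im with hy
    have him : 0 < ((y : ℂ) * I).im := by simpa using hτ
    have hs := (summable_jacobiTheta₂_term_iff 0 τ).mpr hτ
    have hn : ∀ n : ℤ, ((‖jacobiTheta₂_term n 0 τ‖ : ℝ) : ℂ) = jacobiTheta₂_term n 0 (y * I) := by
      intro n
      rw [norm_jacobiTheta₂_term, jacobiTheta₂_term]
      push_cast
      congr 1
      simp only [zero_im, ofReal_zero, mul_zero, sub_zero, zero_add]
      linear_combination (-Real.pi * (n:ℂ)^2 * y) * I_sq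
    have h1 : ‖jacobiTheta₂ 0 τ‖ ≤ ‖jacobiTheta₂ 0 (y * I)‖ := by
      have e : jacobiTheta₂ 0 (y * I) = ((∑' n : ℤ, ‖jacobiTheta₂_term n 0 τ‖ : ℝ) : ℂ) := by
        rw [ofReal_tsum]
        exact tsum_congr fun n => (hn n).symm
      rw [e, norm_real, Real.norm_of_nonneg (tsum_nonneg fun n => norm_nonneg _)]
      exact norm_tsum_le_tsum_norm hs.norm
    have h2 : ‖jacobiTheta₂ 0 (y * I)‖ ≤ √(1 / y) * C := by
      rw [jacobiTheta₂_functional_equation]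
      have hI := I_ne_zero
      have hy0 : (y : ℂ) ≠ 0 := by exact_mod_cast hτ.ne'
      have e1 : -I * (y * I) = y := by linear_combination (-(y:ℂ)) * I_sq
      have e2 : -1 / (y * I) = ((1 / y : ℝ) : ℂ) * I := by
        push_cast; field_simp; rw [I_sq]
      rw [e1, e2]
      simp only [ne_eq, OfNat.ofNat_ne_zero, not_false_eq_true, zero_pow, mul_zero, zero_div,
        Complex.exp_zero, mul_one]
      rw [norm_mul]
      have e3 : ‖1 / (y : ℂ) ^ (1 / 2 : ℂ)‖ = √(1 / y) := by
        rw [norm_div, norm_one, norm_cpow_eq_rpow_re_of_pos hτ, Real.sqrt_div zero_le_one,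
          Real.sqrt_one, Real.sqrt_eq_rpow]
        norm_num
      rw [e3]
      gcongr
      apply big
      simp only [mul_im, ofReal_re, I_im, mul_one, ofReal_im, I_re, mul_zero, add_zero]
      rw [le_div_iff₀ hτ]; linarith
    calc _ ≤ √(1 / y) * C := h1.trans h2
      _ = C * √(1 / y) := mul_comm _ _
      _ ≤ _ := by gcongr; linarith

lemma thF_bound (N : ℕ) (hN : 1 ≤ N) : ∃ C : ℝ, 0 < C ∧ ∀ τ : ℂ, 0 < τ.im →
    ‖thF N τ‖ ≤ C * (1 + 1 / τ.im) := by
  obtain ⟨C, hC, h⟩ := theta_bound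
  refine ⟨C * C, by positivity, fun τ hτ => ?_⟩
  have hN' : (1:ℝ) ≤ N := by exact_mod_cast hN
  have i1 : (2 * τ).im = 2 * τ.im := by
    have := im_ofReal_mul 2 τ
    push_cast at this
    exact this
  have i2 : (2 * (N * τ)).im = 2 * (N * τ.im) := by
    have := im_ofReal_mul (2 * N) τ
    push_cast at this
    rw [← mul_assoc, this]; ring
  have h1 := h (2 * τ) (by rw [i1]; positivity)
  have h2 := h (2 * (N * τ)) (by rw [i2]; positivity)
  rw [i1] at h1
  rw [i2] at h2
  have s1 : √(1 + 1 / (2 * τ.im)) ≤ √(1 + 1 / τ.im) := by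
    gcongr; linarith
  have s2 : √(1 + 1 / (2 * (N * τ.im))) ≤ √(1 + 1 / τ.im) := by
    gcongr; nlinarith
  rw [thF, norm_mul]
  calc _ ≤ (C * √(1 + 1 / τ.im)) * (C * √(1 + 1 / τ.im)) := by
        gcongr
        · exact h1.trans (by gcongr)
        · exact h2.trans (by gcongr)
    _ = C * C * (√(1 + 1 / τ.im) * √(1 + 1 / τ.im)) := by ring
    _ = _ := by rw [Real.mul_self_sqrt (by positivity)]

open UpperHalfPlane ModularForm in
lemma thF_slash (N : ℕ) (hN : N.Prime) (hodd : N ≠ 2) (γ : Matrix.SpecialLinearGroup (Fin 2) ℤ)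
    (hγ : γ ∈ Gamma1 (4 * N)) :
    (fun τ : UpperHalfPlane => thF N τ) ∣[(1:ℤ)] γ = fun τ : UpperHalfPlane => thF N τ := by
  ext τ
  rw [ModularForm.slash_action_eq'_iff, zpow_one]
  rw [Gamma1_mem] at hγ
  obtain ⟨-, h2, h3⟩ := hγ
  have hdet := γ.det_coe
  rw [Matrix.det_fin_two] at hdet
  have key := thF_general N hN hodd (γ 0 0) (γ 0 1) (γ 1 0) (γ 1 1) hdet
    (by rw [ZMod.intCast_zmod_eq_zero_iff_dvd] at h3; exact_mod_cast h3)
    (by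
      have : ((1 : ℤ) : ZMod (4 * N)) = ((γ 1 1 : ℤ) : ZMod (4 * N)) := by simp [h2]
      rw [ZMod.intCast_eq_intCast_iff_dvd_sub] at this; exact_mod_cast this) τ τ.im_pos
  rw [← key]
  congr 1
  rw [UpperHalfPlane.coe_specialLinearGroup_apply]
  simp

open UpperHalfPlane ModularForm in
lemma thF_bdd (N : ℕ) (hN : N.Prime) (hodd : N ≠ 2) (γ : Matrix.SpecialLinearGroup (Fin 2) ℤ) :
    IsBoundedAtImInfty ((fun τ : UpperHalfPlane => thF N τ) ∣[(1:ℤ)] γ) := by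
  obtain ⟨C, hC, hb⟩ := thF_bound N hN.one_lt.le
  set H := (fun τ : UpperHalfPlane => thF N τ) ∣[(1:ℤ)] γ with hH
  have hper : ∀ (k : ℤ) (τ : UpperHalfPlane), H (((4 * N * k : ℝ)) +ᵥ τ) = H τ := by
    intro k τ
    set T' := ModularGroup.T ^ (4 * N * k : ℤ) with hT'
    have hmem : γ * T' * γ⁻¹ ∈ Gamma1 (4 * N) := by
      have h1 : T' ∈ CongruenceSubgroup.Gamma (4 * N) := by
        rw [Gamma_mem, hT', ModularGroup.coe_T_zpow]
        have : ((4 : ZMod (4 * N)) * N * k) = 0 := by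
          have : ((4 * N : ℕ) : ZMod (4 * N)) = 0 := ZMod.natCast_self _
          push_cast at this
          rw [this, zero_mul]
        simp [this]
      have h2 := (Gamma_normal (4 * N)).conj_mem _ h1 γ
      rw [Gamma_mem] at h2
      rw [Gamma1_mem]
      exact ⟨h2.1, h2.2.2.2, h2.2.2.1⟩
    have h3 : H ∣[(1:ℤ)] T' = H := by
      rw [hH, ← SlashAction.slash_mul, show γ * T' = (γ * T' * γ⁻¹) * γ by group,
        SlashAction.slash_mul, thF_slash N hN hodd _ hmem]
    have h4 := congrFun h3 τ
    rw [ModularForm.slash_action_eq'_iff] at h4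
    rw [hT', UpperHalfPlane.modular_T_zpow_smul, ModularGroup.coe_T_zpow] at h4
    simpa using h4
  rw [UpperHalfPlane.isBoundedAtImInfty_iff]
  set c : ℝ := ((γ 1 0 : ℤ) : ℝ) with hc
  set d : ℝ := ((γ 1 1 : ℤ) : ℝ) with hd
  refine ⟨C * (1 + (|c| * (4 * N + 1) + |d|)), 1, fun τ₀ hτ₀ => ?_⟩
  have hN' : (0:ℝ) < N := by exact_mod_cast hN.pos
  obtain ⟨τ, hτ, hre, hval⟩ : ∃ τ : UpperHalfPlane, 1 ≤ τ.im ∧ |τ.re| ≤ 4 * N ∧ H τ₀ = H τ := by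
    set k : ℤ := -⌊τ₀.re / (4 * N)⌋ with hk
    refine ⟨((4 * N * k : ℝ)) +ᵥ τ₀, by simpa using hτ₀, ?_, (hper k τ₀).symm⟩
    rw [vadd_re]
    have h1 := Int.floor_le (τ₀.re / (4 * N))
    have h2 := Int.lt_floor_add_one (τ₀.re / (4 * N))
    rw [le_div_iff₀ (by positivity)] at h1
    rw [div_lt_iff₀ (by positivity)] at h2
    rw [abs_le, hk]
    push_cast
    constructor <;> nlinarith
  rw [hval, hH, SL_slash_apply, zpow_neg, zpow_one, norm_mul, norm_inv]
  have hD : denom γ τ = (c : ℂ) * τ + d := by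
    simp [denom, hc, hd]
  have h1 := hb (γ • τ : UpperHalfPlane) (γ • τ).im_pos
  have him : (γ • τ : UpperHalfPlane).im = τ.im / ‖denom γ τ‖ ^ 2 := by
    rw [ModularGroup.im_smul_eq_div_normSq, normSq_eq_norm_sq]
  have hn1 : 1 ≤ ‖denom γ τ‖ := by
    rw [← one_le_sq_iff₀ (norm_nonneg _), ← normSq_eq_norm_sq, hD, normSq_apply]
    simp only [add_re, add_im, re_ofReal_mul, im_ofReal_mul, ofReal_re, ofReal_im, coe_re, coe_im,
      add_zero]
    by_cases h : γ 1 0 = 0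
    · have hdet := γ.det_coe
      rw [Matrix.det_fin_two, h] at hdet
      have : IsUnit (γ 1 1) := IsUnit.of_mul_eq_one (γ 0 0) (by linarith)
      have hc' : c = 0 := by simp [hc, h]
      rcases Int.isUnit_iff.mp this with h' | h'
      · have : d = 1 := by simp [hd, h']
        rw [hc', this]; norm_num
      · have : d = -1 := by simp [hd, h']
        rw [hc', this]; norm_num
    · have h5 : 1 ≤ |c| := by
        rw [hc]; exact_mod_cast Int.one_le_abs h
      have h6 : 1 ≤ |c * τ.im| := by
        rw [abs_mul, abs_of_pos τ.im_pos]; nlinarith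
      have h7 : 1 ≤ (c * τ.im) ^ 2 := by
        rw [← sq_abs]; nlinarith
      nlinarith [sq_nonneg (c * τ.re + d)]
  have hn2 : ‖denom γ τ‖ ≤ τ.im * (|c| * (4 * N + 1) + |d|) := by
    rw [hD]
    have hτn : ‖(τ : ℂ)‖ ≤ 4 * N + τ.im := by
      refine (norm_le_abs_re_add_abs_im _).trans ?_
      rw [coe_re, coe_im, abs_of_pos τ.im_pos]
      linarith
    calc _ ≤ ‖(c : ℂ) * τ‖ + ‖(d : ℂ)‖ := norm_add_le _ _
      _ = |c| * ‖(τ : ℂ)‖ + |d| := by simp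
      _ ≤ |c| * (4 * N + τ.im) + |d| := by gcongr
      _ ≤ |c| * (τ.im * (4 * N) + τ.im) + τ.im * |d| := by
        have e1 : 4 * (N:ℝ) ≤ τ.im * (4 * N) := le_mul_of_one_le_left (by positivity) hτ
        have e2 : |d| ≤ τ.im * |d| := le_mul_of_one_le_left (abs_nonneg _) hτ
        have e3 := mul_le_mul_of_nonneg_left e1 (abs_nonneg c)
        linarith
      _ = _ := by ring
  have hpos : 0 < ‖denom γ τ‖ := by linarith
  rw [coe_im, him] at h1
  have hy := τ.im_pos
  calc _ ≤ C * (1 + 1 / (τ.im / ‖denom γ τ‖ ^ 2)) * ‖denom γ τ‖⁻¹ := by gcongr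
    _ = C * (‖denom γ τ‖⁻¹ + ‖denom γ τ‖ / τ.im) := by field_simp
    _ ≤ C * (1 + (|c| * (4 * N + 1) + |d|)) := by
      gcongr
      · exact inv_le_one_of_one_le₀ hn1
      · rw [div_le_iff₀ hy]; linarith

lemma theta_differentiableAt (z : ℂ) (hz : 0 < z.im) (r : ℝ) (hr : 0 < r) :
    DifferentiableAt ℂ (fun z : ℂ => jacobiTheta₂ 0 (r * z)) z := by
  refine DifferentiableAt.comp z (f := fun z : ℂ => r * z)
    (differentiableAt_jacobiTheta₂_snd 0 ?_) (by fun_prop)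
  rw [im_ofReal_mul]; positivity

lemma thF_hasSum (N : ℕ) (hN : N.Prime) (τ : ℂ) (hτ : 0 < τ.im) :
    HasSum (fun p : ℤ × ℤ =>
        Complex.exp (2 * Real.pi * Complex.I *
          ((p.1 : ℂ) ^ 2 + (N : ℂ) * (p.2 : ℂ) ^ 2) * τ)) (thF N τ) := by
  have hN' : (0:ℝ) < N := by exact_mod_cast hN.pos
  have i1 : 0 < (2 * τ).im := by
    have := im_ofReal_mul 2 τ
    push_cast at this
    rw [this]; positivity
  have i2 : 0 < (2 * (N * τ)).im := by
    have := im_ofReal_mul (2 * N) τ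
    push_cast at this
    rw [← mul_assoc, this]; positivity
  have s1 := hasSum_jacobiTheta₂_term 0 i1
  have s2 := hasSum_jacobiTheta₂_term 0 i2
  have n1 : Summable fun n : ℤ => ‖jacobiTheta₂_term n 0 (2 * τ)‖ := s1.summable.norm
  have n2 : Summable fun n : ℤ => ‖jacobiTheta₂_term n 0 (2 * (N * τ))‖ := s2.summable.norm
  have sm := summable_mul_of_summable_norm n1 n2
  have key := s1.mul s2 sm
  have e : (fun p : ℤ × ℤ => Complex.exp (2 * Real.pi * Complex.I *
      ((p.1 : ℂ) ^ 2 + (N : ℂ) * (p.2 : ℂ) ^ 2) * τ)) = fun p : ℤ × ℤ =>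
      jacobiTheta₂_term p.1 0 (2 * τ) * jacobiTheta₂_term p.2 0 (2 * (N * τ)) := by
    funext p
    simp only [jacobiTheta₂_term, ← Complex.exp_add]
    congr 1
    ring
  rw [e, thF]
  exact key

/-- For an odd prime `N`, the theta series `Σ_{m,n ∈ ℤ} q^{m² + N n²}` (with `q = e^{2πiτ}`)
is a modular form of weight 1 and level `Γ₁(4N)`. -/
theorem theta_series_modular_form
    (N : ℕ) (hN : N.Prime) (hodd : N ≠ 2) :
    ∃ g : ModularForm (Gamma1 (4 * N)) 1, ∀ τ : UpperHalfPlane,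
      Summable (fun p : ℤ × ℤ =>
        Complex.exp (2 * Real.pi * Complex.I *
          ((p.1 : ℂ) ^ 2 + (N : ℂ) * (p.2 : ℂ) ^ 2) * (τ : ℂ))) ∧
      g τ = ∑' p : ℤ × ℤ,
        Complex.exp (2 * Real.pi * Complex.I *
          ((p.1 : ℂ) ^ 2 + (N : ℂ) * (p.2 : ℂ) ^ 2) * (τ : ℂ)) := by
  have : NeZero (4 * N) := ⟨by have := hN.pos; omega⟩
  have hN' : (0:ℝ) < N := by exact_mod_cast hN.pos
  refine ⟨{ toFun := fun τ => thF N τ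
            slash_action_eq' := ?_
            holo' := ?_
            bdd_at_cusps' := ?_ }, fun τ => ?_⟩
  · rintro _ ⟨γ, hγ, rfl⟩
    exact thF_slash N hN hodd γ hγ
  · rw [UpperHalfPlane.mdifferentiable_iff]
    have : DifferentiableOn ℂ (thF N) {z | 0 < z.im} := by
      intro z hz
      have h1 := theta_differentiableAt z hz 2 two_pos
      have h2 := theta_differentiableAt z hz (2 * N) (by positivity)
      have := (h1.mul h2).differentiableWithinAt (s := {z | 0 < z.im})
      refine this.congr_of_eventuallyEq (Filter.Eventually.of_forall fun x => ?_) ?_ <;>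
        simp [thF, mul_assoc]
    refine this.congr fun z hz => ?_
    simp [UpperHalfPlane.ofComplex_apply_of_im_pos hz]
  · intro c hc
    rw [Subgroup.IsArithmetic.isCusp_iff_isCusp_SL2Z] at hc
    rw [OnePoint.isBoundedAt_iff_forall_SL2Z hc]
    exact fun γ _ => thF_bdd N hN hodd γ
  · have := thF_hasSum N hN τ τ.im_pos
    exact ⟨this.summable, this.tsum_eq.symm⟩
end
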